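/- arXiv:0811.3649 — 2 statements merged into one kernel-verified Lean document; each statement's English description precedes it below -/
import Mathlib

section
/- For q odd, β odd, and β < n, the double character sum satisfies S(β; n) = −η_n·π_q(n)·q^{β − n/2} + O(q^n), where η_n = 1 if n is even and 0 if n is odd. -/
open Polynomial
open scoped Classical

/-- The quadratic residue symbol `(B/P)` for `P` a monic irreducible polynomial:
`0` if `P ∣ B`, `1` if `B` is a nonzero square modulo `P`, and `-1` otherwise. -/
noncomputable def legendreSymbol {F : Type*} [Field F] (B P : F[X]) : ℤ :=
  if P ∣ B then 0 else if ∃ C : F[X], P ∣ (C ^ 2 - B) then 1 else -1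

/-- The double character sum
`S(β; n) = Σ_{P monic irreducible, deg P = n} Σ_{B monic, deg B = β} (B/P)`. -/
noncomputable def doubleCharSum (F : Type*) [Field F] (β n : ℕ) : ℤ :=
  ∑ᶠ P ∈ {P : F[X] | P.Monic ∧ Irreducible P ∧ P.natDegree = n},
    ∑ᶠ B ∈ {B : F[X] | B.Monic ∧ B.natDegree = β}, legendreSymbol B P

/-- `π_q(n)`, the number of monic irreducible polynomials of degree `n`. -/
noncomputable def primeCount (F : Type*) [Field F] (n : ℕ) : ℕ :=
  {P : F[X] | P.Monic ∧ Irreducible P ∧ P.natDegree = n}.ncard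

/-- The polynomial of degree less than `k` with prescribed coefficients. -/
noncomputable def polyOfFin {R : Type*} [Ring R] (k : ℕ) : (Fin k → R) →ₗ[R] R[X] :=
  (degreeLT R k).subtype ∘ₗ (degreeLTEquiv R k).symm.toLinearMap

theorem degree_polyOfFin_lt {R : Type*} [Ring R] {k : ℕ} (w : Fin k → R) :
    (polyOfFin k w).degree < k :=
  mem_degreeLT.1 ((degreeLTEquiv R k).symm w).2

theorem polyOfFin_injective {R : Type*} [Ring R] (k : ℕ) :
    Function.Injective (polyOfFin (R := R) k) :=
  Subtype.val_injective.comp (degreeLTEquiv R k).symm.injective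

theorem exists_polyOfFin_eq {R : Type*} [Ring R] {k : ℕ} {g : R[X]} (hg : g.degree < k) :
    ∃ w, polyOfFin k w = g :=
  ⟨degreeLTEquiv R k ⟨g, mem_degreeLT.2 hg⟩, by simp [polyOfFin]⟩

/-- If `X ^ p ^ b` divides `r + s * f ^ e` with `2 * e = p ^ b + 1` and `r`, `s` of small degree,
then `r` and `s` vanish, unless `f` is a constant times a square. -/
theorem eq_zero_of_X_pow_dvd_add_mul_pow {K : Type*} [Field K] {p : ℕ} [Fact p.Prime] [CharP K p]
    {b e A : ℕ} (he : 2 * e = p ^ b + 1) {f r s : K[X]} (hf0 : f.coeff 0 ≠ 0)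
    (hf : ∀ (c : K) (g : K[X]), f ≠ C c * g ^ 2) (hA : 2 * A + f.natDegree ≤ p ^ b)
    (hr : r.degree < A) (hs : s.degree < A) (hdvd : X ^ p ^ b ∣ r + s * f ^ e) :
    r = 0 ∧ s = 0 := by
  have hfrob : X ^ p ^ b ∣ f ^ p ^ b - C (f.coeff 0 ^ p ^ b) := by
    rw [C_pow, ← sub_pow_char_pow]
    exact pow_dvd_pow_of_dvd (by rw [X_dvd_iff]; simp) _
  have hdvd' : X ^ p ^ b ∣ r ^ 2 - C (f.coeff 0 ^ p ^ b) * s ^ 2 * f := by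
    have h1 : r ^ 2 - C (f.coeff 0 ^ p ^ b) * s ^ 2 * f =
        (r + s * f ^ e) * (r - s * f ^ e) +
          (f ^ p ^ b - C (f.coeff 0 ^ p ^ b)) * (s ^ 2 * f) := by
      have : f ^ e * f ^ e = f ^ p ^ b * f := by
        rw [← pow_add, ← pow_succ, ← he, two_mul]
      linear_combination (s ^ 2) * this
    rw [h1]
    exact dvd_add (hdvd.mul_right _) (hfrob.mul_right _)
  set c := f.coeff 0 ^ p ^ b with hc
  have hc0 : c ≠ 0 := pow_ne_zero _ hf0
  have hf_ne : f ≠ 0 := fun h => hf0 (by simp [h])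
  have hA0 : ∀ {t : K[X]}, t.degree < A → t ≠ 0 → t.natDegree < A := fun h h0 =>
    (natDegree_lt_iff_degree_lt h0).2 h
  have hzero : r ^ 2 - C c * s ^ 2 * f = 0 := by
    refine eq_zero_of_dvd_of_degree_lt hdvd' ?_
    rw [degree_X_pow]
    refine (degree_sub_le _ _).trans_lt (max_lt ?_ ?_)
    · by_cases h0 : r = 0
      · rw [h0, zero_pow two_ne_zero, degree_zero]
        exact WithBot.bot_lt_coe _
      · refine (degree_le_natDegree).trans_lt ?_
        have := hA0 hr h0
        rw [natDegree_pow]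
        exact_mod_cast (by omega)
    · by_cases h0 : s = 0
      · rw [h0, zero_pow two_ne_zero, mul_zero, zero_mul, degree_zero]
        exact WithBot.bot_lt_coe _
      · refine (degree_le_natDegree).trans_lt ?_
        have := hA0 hs h0
        rw [natDegree_mul (mul_ne_zero (by simpa using hc0) (pow_ne_zero _ h0)) hf_ne,
          natDegree_C_mul hc0, natDegree_pow]
        exact_mod_cast (by omega)
  have heq : r ^ 2 = C c * s ^ 2 * f := sub_eq_zero.1 hzero
  have hs0 : s = 0 := by
    by_contra hs0
    have : s ^ 2 ∣ r ^ 2 := ⟨C c * f, by rw [heq]; ring⟩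
    obtain ⟨t, rfl⟩ := (IsIntegrallyClosed.pow_dvd_pow_iff two_ne_zero).1 this
    have h2 : t ^ 2 = C c * f := by
      have : s ^ 2 * t ^ 2 = s ^ 2 * (C c * f) := by rw [← mul_pow, heq]; ring
      exact mul_left_cancel₀ (pow_ne_zero _ hs0) this
    refine hf c⁻¹ t ?_
    rw [h2, ← mul_assoc, ← C_mul, inv_mul_cancel₀ hc0, C_1, one_mul]
  subst hs0
  simpa using heq

theorem eq_zero_of_sum_add_mul_pow_mul_X_pow_eq_zero {K : Type*} [Field K] {p : ℕ} [Fact p.Prime]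
    [CharP K p] {b e A J : ℕ} (he : 2 * e = p ^ b + 1) {f : K[X]} {r s : ℕ → K[X]}
    (hf0 : f.coeff 0 ≠ 0) (hf : ∀ (c : K) (g : K[X]), f ≠ C c * g ^ 2)
    (hA : 2 * A + f.natDegree ≤ p ^ b) (hr : ∀ j, (r j).degree < A) (hs : ∀ j, (s j).degree < A)
    (h : ∑ j ∈ Finset.range J, (r j + s j * f ^ e) * X ^ (j * p ^ b) = 0) (j : ℕ) (hj : j < J) :
    r j = 0 ∧ s j = 0 := by
  induction j using Nat.strong_induction_on with
  | _ j ih =>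
    refine eq_zero_of_X_pow_dvd_add_mul_pow he hf0 hf hA (hr j) (hs j) ?_
    have hsplit := Finset.sum_range_add_sum_Ico
      (fun j => (r j + s j * f ^ e) * X ^ (j * p ^ b)) (Nat.succ_le_of_lt hj)
    rw [h, Finset.sum_range_succ, Finset.sum_eq_zero (s := Finset.range j), zero_add] at hsplit
    · have hd : X ^ (j * p ^ b) * X ^ p ^ b ∣
          ∑ i ∈ Finset.Ico (j + 1) J, (r i + s i * f ^ e) * X ^ (i * p ^ b) := by
        refine Finset.dvd_sum fun i hi => Dvd.dvd.mul_left ?_ _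
        rw [← pow_add]
        refine pow_dvd_pow _ ?_
        rw [← Nat.succ_mul]
        exact Nat.mul_le_mul_right _ (Finset.mem_Ico.1 hi).1
      have hd' : X ^ (j * p ^ b) * X ^ p ^ b ∣ X ^ (j * p ^ b) * (r j + s j * f ^ e) := by
        rw [mul_comm _ (r j + _), eq_neg_of_add_eq_zero_left hsplit]
        exact hd.neg_right
      exact (mul_dvd_mul_iff_left (pow_ne_zero _ X_ne_zero)).1 hd'
    · intro i hi
      have hi' := Finset.mem_range.1 hi
      obtain ⟨h1, h2⟩ := ih i hi' (hi'.trans hj)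
      simp [h1, h2]

theorem degree_sum_pow_add_mul_pow_lt {K : Type*} [Field K] {N e A J : ℕ} (hA : 0 < A)
    (hN : 0 < N) (hJ : 0 < J) (f : K[X]) (u : K) {r s : ℕ → K[X]} (hr : ∀ j, (r j).degree < A)
    (hs : ∀ j, (s j).degree < A) :
    (∑ j ∈ Finset.range J, (r j ^ N + C u * s j ^ N * f ^ e) * X ^ j).degree <
      ((A * N + f.natDegree * e + J : ℕ) : WithBot ℕ) := by
  have hdeg : ∀ w : K[X], w.degree < A → (w ^ N).natDegree ≤ (A - 1) * N := fun w hw => by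
    rw [natDegree_pow, mul_comm]
    refine Nat.mul_le_mul_right _ (Nat.le_sub_one_of_lt ?_)
    by_cases h0 : w = 0
    · simpa [h0] using hA
    · exact (natDegree_lt_iff_degree_lt h0).2 hw
  have h4 : (A - 1) * N + N = A * N := by
    rw [← Nat.succ_mul, Nat.succ_eq_add_one, Nat.sub_add_cancel hA]
  refine degree_le_natDegree.trans_lt (Nat.cast_lt.2 (lt_of_le_of_lt (natDegree_sum_le_of_forall_le
    (n := (A - 1) * N + f.natDegree * e + (J - 1)) _ _ fun j hj => ?_) (by omega)))
  have hj' : j ≤ J - 1 := Nat.le_sub_one_of_lt (Finset.mem_range.1 hj)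
  refine natDegree_mul_le_of_le (natDegree_add_le_of_degree_le ?_ ?_)
    ((natDegree_X_pow_le _).trans hj')
  · exact (hdeg _ (hr j)).trans (Nat.le_add_right _ _)
  · refine natDegree_mul_le_of_le ((natDegree_C_mul_le _ _).trans (hdeg _ (hs j))) ?_
    rw [natDegree_pow, mul_comm]

/-- The linear system behind the Stepanov method has a nontrivial solution as soon as there are more
unknowns than equations. -/
theorem exists_ne_zero_sum_pow_add_mul_pow_eq_zero {K : Type*} [Field K] [Finite K] {p : ℕ}
    [Fact p.Prime] [CharP K p] {a e A J : ℕ} (hA : 0 < A) (f : K[X]) (u : K)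
    (hJ : A * p ^ a + f.natDegree * e + J < 2 * A * J) :
    ∃ r s : ℕ → K[X], (∀ j, (r j).degree < A) ∧ (∀ j, (s j).degree < A) ∧
      (∃ j < J, ¬ (r j = 0 ∧ s j = 0)) ∧
      ∑ j ∈ Finset.range J, (r j ^ p ^ a + C u * s j ^ p ^ a * f ^ e) * X ^ j = 0 := by
  have := Fintype.ofFinite K
  have hp : 0 < p ^ a := pow_pos (Fact.out : p.Prime).pos _
  have hJ0 : 0 < J := Nat.pos_of_ne_zero fun h => by simp [h] at hJ
  let ρ : (Fin J → Fin A → K) → ℕ → K[X] := fun z j =>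
    if hj : j < J then polyOfFin A (z ⟨j, hj⟩) else 0
  have hρ : ∀ z j, (ρ z j).degree < A := fun z j => by
    by_cases hj : j < J
    · simpa only [ρ, dif_pos hj] using degree_polyOfFin_lt _
    · simp only [ρ, dif_neg hj, degree_zero]
      exact WithBot.bot_lt_coe _
  have hρ_sub : ∀ z z' j, ρ (z - z') j = ρ z j - ρ z' j := fun z z' j => by
    by_cases hj : j < J <;> simp [ρ, hj]
  let Φ : (Fin J → Fin A → K) × (Fin J → Fin A → K) → K[X] := fun v =>
    ∑ j ∈ Finset.range J, (ρ v.1 j ^ p ^ a + C u * ρ v.2 j ^ p ^ a * f ^ e) * X ^ j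
  have hcard : Fintype.card (Fin (A * p ^ a + f.natDegree * e + J) → K) <
      Fintype.card ((Fin J → Fin A → K) × (Fin J → Fin A → K)) := by
    simp only [Fintype.card_pi, Fintype.card_prod, Finset.prod_const, Finset.card_univ,
      Fintype.card_fin]
    rw [← pow_mul, ← pow_add, ← two_mul, ← mul_assoc]
    exact Nat.pow_lt_pow_right Fintype.one_lt_card hJ
  choose w hw using fun v => exists_polyOfFin_eq
    (degree_sum_pow_add_mul_pow_lt (e := e) hA hp hJ0 f u (hρ (Prod.fst v)) (hρ (Prod.snd v)))
  obtain ⟨v, v', hne, hvv'⟩ := Fintype.exists_ne_map_eq_of_card_lt w hcard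
  have hΦ : Φ v - Φ v' = 0 := by
    rw [sub_eq_zero]
    exact (hw v).symm.trans ((congrArg _ hvv').trans (hw v'))
  refine ⟨ρ (v.1 - v'.1), ρ (v.2 - v'.2), hρ _, hρ _, ?_, ?_⟩
  · by_contra! hall
    have hz : ∀ z : Fin J → Fin A → K, (∀ j < J, ρ z j = 0) → z = 0 := fun z h => funext fun j => by
      have := h j j.2
      simp only [ρ, dif_pos j.2] at this
      exact polyOfFin_injective A (this.trans (map_zero _).symm)
    exact hne (Prod.ext (sub_eq_zero.1 (hz _ fun j hj => (hall j hj).1))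
      (sub_eq_zero.1 (hz _ fun j hj => (hall j hj).2)))
  · rw [← hΦ, ← Finset.sum_sub_distrib]
    refine Finset.sum_congr rfl fun j _ => ?_
    rw [hρ_sub, hρ_sub, sub_pow_char_pow, sub_pow_char_pow]
    ring

/-- Upper bound for the number of points where `f` takes values in a fixed class modulo squares. -/
theorem two_mul_card_quadraticChar_eval_eq_le {K : Type*} [Field K] [Fintype K] {p : ℕ}
    [Fact p.Prime] [CharP K p] (hp : p ≠ 2) {a b : ℕ} (hK : Fintype.card K = p ^ a * p ^ b)
    (hab : a ≤ b) {f : K[X]} (hf0 : f.coeff 0 ≠ 0) (hf : ∀ (c : K) (g : K[X]), f ≠ C c * g ^ 2)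
    (hM : 2 * f.natDegree < p ^ a) (hq : 2 * f.natDegree + 4 ≤ p ^ b) (hm : 0 < f.natDegree)
    (u : ℤ) :
    2 * (Finset.univ.filter fun x : K => quadraticChar K (f.eval x) = u).card ≤
      p ^ a * p ^ b + 6 * f.natDegree * p ^ b := by
  have hpodd : Odd p := (Fact.out : p.Prime).odd_of_ne_two hp
  have hMo : Odd (p ^ a) := hpodd.pow
  have hqo : Odd (p ^ b) := hpodd.pow
  have hle : p ^ a ≤ p ^ b := Nat.pow_le_pow_right (Fact.out : p.Prime).pos hab
  set m := f.natDegree with hmdef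
  obtain ⟨M', hM'⟩ := hMo
  obtain ⟨q', hq'⟩ := hqo
  have hchar : ringChar K ≠ 2 := by rwa [ringChar.eq K p]
  have hcard2 : Fintype.card K / 2 + (M' + 1) = (q' + 1) * p ^ a := by
    have : Fintype.card K = 2 * (2 * M' * q' + M' + q') + 1 := by rw [hK, hM', hq']; ring
    rw [hM']
    have h2 : Fintype.card K / 2 = 2 * M' * q' + M' + q' := by omega
    rw [h2]; ring
  set A := (p ^ b - m) / 2 with hAdef
  set J := M' + m + 2 with hJdef
  have hA2 : 2 * A + m ≤ p ^ b := by omega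
  have hA2' : p ^ b ≤ 2 * A + m + 1 := by omega
  have hA0 : 0 < A := by omega
  have hcount : A * p ^ a + m * (M' + 1) + J < 2 * A * J := by
    have hAq : q' ≤ 2 * A - 1 := by omega
    obtain ⟨B, hB⟩ : ∃ B, 2 * A = B + 1 := ⟨2 * A - 1, by omega⟩
    have hqB : q' ≤ B := by omega
    have hMq : M' ≤ q' := by omega
    have hmM : m ≤ M' := by omega
    have hMB : M' ≤ B := hMq.trans hqB
    have e1 : 2 * (A * p ^ a) = (B + 1) * (2 * M' + 1) := by rw [← mul_assoc, hB, hM']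
    have hmul := Nat.mul_le_mul_left m hMB
    rw [hB]
    have hJ' : J = M' + m + 2 := hJdef
    rw [hJ']
    nlinarith [e1, hmul, hMB, hmM]
  obtain ⟨r, s, hr, hs, ⟨j₀, hj₀, hne⟩, hsum⟩ :=
    exists_ne_zero_sum_pow_add_mul_pow_eq_zero (K := K) (p := p) (a := a) (e := M' + 1) (J := J) hA0
      f (u : K) hcount
  set h := ∑ j ∈ Finset.range J, (r j + s j * f ^ (q' + 1)) * X ^ (j * p ^ b) with hh
  have hh0 : h ≠ 0 := fun h0 => hne
    (eq_zero_of_sum_add_mul_pow_mul_X_pow_eq_zero (by omega) hf0 hf hA2 hr hs (hh.symm.trans h0)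
      j₀ hj₀)
  have hdeg : h.natDegree ≤ A + m * (q' + 1) + (J - 1) * p ^ b := by
    refine natDegree_sum_le_of_forall_le _ _ fun j hj => ?_
    have hj' : j ≤ J - 1 := Nat.le_sub_one_of_lt (Finset.mem_range.1 hj)
    have hlt : ∀ t : K[X], t.degree < A → t.natDegree ≤ A := fun t ht =>
      natDegree_le_of_degree_le ht.le
    refine natDegree_mul_le_of_le (natDegree_add_le_of_degree_le ((hlt _ (hr j)).trans
      (Nat.le_add_right _ _)) (natDegree_mul_le_of_le (hlt _ (hs j)) ?_)) ?_
    · rw [natDegree_pow, mul_comm]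
    · rw [natDegree_X_pow]
      exact Nat.mul_le_mul_right _ hj'
  have hroot : ∀ x : K, quadraticChar K (f.eval x) = u → h.eval x = 0 := by
    intro x hx
    have hxe : (u : K) * f.eval x ^ (M' + 1) = f.eval x ^ ((q' + 1) * p ^ a) := by
      rw [← hx, quadraticChar_eq_pow_of_char_ne_two' hchar, ← pow_add, hcard2]
    have hz : h.eval x ^ p ^ a = 0 := by
      rw [hh, eval_finsetSum, sum_pow_char_pow]
      have := congrArg (eval x) hsum
      rw [eval_finsetSum, eval_zero] at this
      rw [← this]
      refine Finset.sum_congr rfl fun j _ => ?_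
      simp only [eval_mul, eval_add, eval_pow, eval_X, eval_C, mul_pow, add_pow_char_pow]
      have hx1 : (x ^ (j * p ^ b)) ^ p ^ a = x ^ j := by
        rw [← pow_mul, mul_assoc, mul_comm (p ^ b), ← hK, mul_comm, pow_mul, FiniteField.pow_card]
      rw [hx1, ← pow_mul, ← hxe]
      ring
    exact pow_eq_zero_iff (pow_pos (Fact.out : p.Prime).pos _).ne' |>.1 hz
  have hcardle : (Finset.univ.filter fun x : K => quadraticChar K (f.eval x) = u).card ≤
      h.natDegree := by
    refine le_trans ?_ (card_roots' h)
    refine le_trans (Finset.card_le_card fun x hx => ?_) (Multiset.toFinset_card_le _)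
    rw [Multiset.mem_toFinset, mem_roots hh0]
    exact hroot x (Finset.mem_filter.1 hx).2
  have hfin : 2 * (A + m * (q' + 1) + (J - 1) * p ^ b) ≤ p ^ a * p ^ b + 6 * m * p ^ b := by
    have hJ1 : J - 1 = M' + m + 1 := by omega
    rw [hJ1]
    have : 2 * A + m ≤ 2 * q' + 1 := by omega
    rw [hM', hq']
    nlinarith [Nat.mul_le_mul_right q' hm]
  omega

/-- **Weil bound** for quadratic character sums of polynomials, by the Stepanov method. -/
theorem abs_sum_quadraticChar_eval_le {K : Type*} [Field K] [Fintype K] {p : ℕ}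
    [Fact p.Prime] [CharP K p] (hp : p ≠ 2) {a b : ℕ} (hK : Fintype.card K = p ^ a * p ^ b)
    (hab : a ≤ b) {f : K[X]} (hf : ∀ (c : K) (g : K[X]), f ≠ C c * g ^ 2) :
    |∑ x : K, quadraticChar K (f.eval x)| ≤ 7 * f.natDegree * p ^ b := by
  have hm : 0 < f.natDegree := by
    refine Nat.pos_of_ne_zero fun h => hf (f.coeff 0) 1 ?_
    rw [one_pow, mul_one]
    exact eq_C_of_natDegree_eq_zero h
  have hle : p ^ a ≤ p ^ b := Nat.pow_le_pow_right (Fact.out : p.Prime).pos hab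
  have hval : ∀ y : K, |quadraticChar K y| ≤ 1 := fun y => by
    rcases quadraticChar_isQuadratic K y with h | h | h <;> simp [h]
  have htriv : |∑ x : K, quadraticChar K (f.eval x)| ≤ p ^ a * p ^ b := by
    refine (Finset.abs_sum_le_sum_abs _ _).trans ((Finset.sum_le_sum fun x _ => hval _).trans ?_)
    simp only [Finset.sum_const, Finset.card_univ, hK, nsmul_eq_mul, mul_one]
    push_cast
    rfl
  by_cases hM : 2 * f.natDegree < p ^ a
  swap
  · refine htriv.trans ?_
    have : p ^ a * p ^ b ≤ 7 * f.natDegree * p ^ b := Nat.mul_le_mul_right _ (by omega)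
    exact_mod_cast this
  by_cases hq : 2 * f.natDegree + 4 ≤ p ^ b
  swap
  · refine htriv.trans ?_
    have : p ^ a * p ^ b ≤ 7 * f.natDegree * p ^ b := Nat.mul_le_mul_right _ (by omega)
    exact_mod_cast this
  have hf_ne : f ≠ 0 := fun h => by simp [h] at hm
  have hroots : (Finset.univ.filter fun x : K => f.eval x = 0).card ≤ f.natDegree := by
    refine le_trans ?_ (card_roots' f)
    refine le_trans (Finset.card_le_card fun x hx => ?_) (Multiset.toFinset_card_le _)
    rw [Multiset.mem_toFinset, mem_roots hf_ne]
    exact (Finset.mem_filter.1 hx).2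
  obtain ⟨x₀, hx₀⟩ : ∃ x₀, f.eval x₀ ≠ 0 := by
    by_contra! h
    rw [Finset.filter_true_of_mem fun x _ => h x, Finset.card_univ, hK] at hroots
    have := Nat.le_mul_of_pos_right (p ^ a) (pow_pos (Fact.out : p.Prime).pos b)
    omega
  set g := f.comp (X + C x₀) with hg
  have hgdeg : g.natDegree = f.natDegree := by rw [hg, natDegree_comp, natDegree_X_add_C, mul_one]
  have hg0 : g.coeff 0 ≠ 0 := by
    rw [coeff_zero_eq_eval_zero, hg, eval_comp]; simpa using hx₀
  have hgsq : ∀ (c : K) (t : K[X]), g ≠ C c * t ^ 2 := fun c t h => hf c (t.comp (X - C x₀)) (by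
    have := congrArg (fun w => w.comp (X - C x₀)) h
    simp only [hg, comp_assoc] at this
    simpa using this)
  have hsum : ∑ x : K, quadraticChar K (f.eval x) = ∑ x : K, quadraticChar K (g.eval x) := by
    rw [← Equiv.sum_comp (Equiv.addRight x₀)]
    simp [hg, eval_comp]
  have h1 := two_mul_card_quadraticChar_eval_eq_le hp hK hab hg0 hgsq (by rwa [hgdeg])
    (by rwa [hgdeg]) (by rwa [hgdeg]) 1
  have h2 := two_mul_card_quadraticChar_eval_eq_le hp hK hab hg0 hgsq (by rwa [hgdeg])
    (by rwa [hgdeg]) (by rwa [hgdeg]) (-1)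
  have hroots' : (Finset.univ.filter fun x : K => quadraticChar K (g.eval x) = 0).card ≤
      f.natDegree := by
    rw [← hgdeg]
    refine le_trans ?_ (card_roots' g)
    refine le_trans (Finset.card_le_card fun x hx => ?_) (Multiset.toFinset_card_le _)
    rw [Multiset.mem_toFinset, mem_roots fun h => hg0 (by simp [h])]
    exact quadraticChar_eq_zero_iff.1 (Finset.mem_filter.1 hx).2
  rw [hgdeg] at h1 h2
  set T := fun u : ℤ => (Finset.univ.filter fun x : K => quadraticChar K (g.eval x) = u).card
    with hT
  have hpart : ∀ φ : ℤ → ℤ, ∑ x : K, φ (quadraticChar K (g.eval x)) =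
      T 1 * φ 1 + T (-1) * φ (-1) + T 0 * φ 0 := by
    intro φ
    have : ∀ x : K, φ (quadraticChar K (g.eval x)) =
        (if quadraticChar K (g.eval x) = 1 then φ 1 else 0) +
        (if quadraticChar K (g.eval x) = -1 then φ (-1) else 0) +
        (if quadraticChar K (g.eval x) = 0 then φ 0 else 0) := fun x => by
      rcases quadraticChar_isQuadratic K (g.eval x) with h | h | h <;> simp [h]
    rw [Finset.sum_congr rfl fun x _ => this x]
    simp only [Finset.sum_add_distrib, ← Finset.sum_filter, Finset.sum_const, nsmul_eq_mul, hT]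
  have htot := hpart fun _ => 1
  have hid := hpart id
  simp only [Finset.sum_const, Finset.card_univ, hK, nsmul_eq_mul, mul_one, id] at htot hid
  rw [hsum, hid]
  have hb1 : (1 : ℤ) ≤ p ^ b := by exact_mod_cast Nat.one_le_pow _ _ (Fact.out : p.Prime).pos
  have hmb : (f.natDegree : ℤ) ≤ f.natDegree * p ^ b := le_mul_of_one_le_right (by positivity) hb1
  zify at h1 h2 hroots'
  push_cast at htot
  rw [abs_le]
  constructor <;> simp only [hT] at * <;> linarith

/-- The monic polynomial of degree `k` with prescribed lower coefficients. -/
noncomputable def monicOfFin {R : Type*} [Ring R] (k : ℕ) (w : Fin k → R) : R[X] :=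
  X ^ k + polyOfFin k w

theorem polyOfFin_apply {R : Type*} [Ring R] {k : ℕ} (w : Fin k → R) :
    polyOfFin k w = ∑ i : Fin k, monomial i (w i) := rfl

theorem polyOfFin_snoc {R : Type*} [Ring R] {k : ℕ} (w : Fin k → R) (c : R) :
    polyOfFin (k + 1) (Fin.snoc w c : Fin (k + 1) → R) = polyOfFin k w + C c * X ^ k := by
  simp [polyOfFin_apply, Fin.sum_univ_castSucc, C_mul_X_pow_eq_monomial]

theorem coeff_polyOfFin_self {R : Type*} [Ring R] {k : ℕ} (w : Fin k → R) :
    (polyOfFin k w).coeff k = 0 :=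
  coeff_eq_zero_of_degree_lt (degree_polyOfFin_lt w)

section QuadraticCharSum

variable {F K : Type*} [Field F] [Fintype F] [Field K] [Fintype K] [Algebra F K]

/-- The sum of the quadratic character of `B θ` over the monic polynomials `B` of degree `k`. -/
noncomputable def monicCharSum (F : Type*) {K : Type*} [Field F] [Fintype F] [Field K] [Fintype K]
    [Algebra F K] (θ : K) (k : ℕ) : ℤ :=
  ∑ w : Fin k → F, quadraticChar K (aeval θ (monicOfFin k w))

/-- The sum of the quadratic character of `B θ` over the polynomials `B` of degree less than `k`. -/
noncomputable def polyCharSum (F : Type*) {K : Type*} [Field F] [Fintype F] [Field K] [Fintype K]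
    [Algebra F K] (θ : K) (k : ℕ) : ℤ :=
  ∑ w : Fin k → F, quadraticChar K (aeval θ (polyOfFin k w))

theorem sum_quadraticChar_aeval_add (θ : K) (k : ℕ) (c : F) :
    ∑ w : Fin k → F, quadraticChar K (aeval θ (polyOfFin k w + C c * X ^ k)) =
      if c = 0 then polyCharSum F θ k else quadraticChar K (algebraMap F K c) * monicCharSum F θ k := by
  split_ifs with hc
  · simp [hc, polyCharSum]
  · rw [monicCharSum, Finset.mul_sum]
    refine (Fintype.sum_equiv (Equiv.smulRight hc) _ _ fun w => ?_).symm
    rw [Equiv.smulRight_apply, ← map_mul, monicOfFin]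
    congr 1
    simp only [map_smul, map_add, map_mul, map_pow, aeval_X, aeval_C]
    rw [Algebra.smul_def]
    ring

theorem sum_mul_quadraticChar_aeval_snoc {R : Type*} [CommRing R] (θ : K) (k : ℕ) (φ : F → R) :
    ∑ v : Fin (k + 1) → F, φ (v (Fin.last k)) * (quadraticChar K (aeval θ (polyOfFin (k + 1) v)) : R)
      = φ 0 * polyCharSum F θ k +
        (∑ c : F, φ c * quadraticChar K (algebraMap F K c)) * monicCharSum F θ k := by
  rw [← Fintype.sum_equiv (Fin.snocEquiv fun _ : Fin (k + 1) => F) (fun x =>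
    φ x.1 * (quadraticChar K (aeval θ (polyOfFin k x.2 + C x.1 * X ^ k)) : R)) _ ?_,
    Fintype.sum_prod_type]
  · simp only [← Finset.mul_sum, ← Int.cast_sum, sum_quadraticChar_aeval_add]
    rw [← Finset.add_sum_erase _ _ (Finset.mem_univ (0 : F)),
      ← Finset.add_sum_erase (a := (0 : F)) _ _ (Finset.mem_univ (0 : F))]
    simp only [if_true, map_zero, MulChar.map_zero, Int.cast_zero, mul_zero, zero_add]
    rw [Finset.sum_mul]
    congr 1
    refine Finset.sum_congr rfl fun c hc => ?_
    rw [if_neg (Finset.ne_of_mem_erase hc)]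
    push_cast
    ring
  · rintro ⟨c, w⟩
    have : (Fin.snocEquiv fun _ : Fin (k + 1) => F) (c, w) = (Fin.snoc w c : Fin (k + 1) → F) := rfl
    rw [this, polyOfFin_snoc, Fin.snoc_last]

theorem polyCharSum_eq (θ : K) (k : ℕ) :
    polyCharSum F θ k =
      (∑ c : F, quadraticChar K (algebraMap F K c)) * ∑ j ∈ Finset.range k, monicCharSum F θ j := by
  induction k with
  | zero => simp [polyCharSum, polyOfFin_apply]
  | succ k ih =>
    have := sum_mul_quadraticChar_aeval_snoc (R := ℤ) θ k (fun _ : F => 1)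
    simp only [one_mul, Int.cast_id] at this
    rw [polyCharSum, this, ih, Finset.sum_range_succ]
    ring

/-- Poisson summation for the quadratic character over short intervals of polynomials. -/
theorem gaussSum_mul_monicCharSum {n : ℕ} {θ : K} {l : K →ₗ[F] F}
    (hl : ∀ g : F[X], g.degree < n → l (aeval θ g) = g.coeff (n - 1))
    (hθ : ∀ a : K, ∃ g : F[X], g.degree < n ∧ aeval θ g = a)
    (hinj : ∀ g : F[X], g.degree < n → aeval θ g = 0 → g = 0) {ψ : AddChar F ℂ} (hψ : ψ ≠ 1) (hK : ringChar K ≠ 2) {k m : ℕ} (hkm : k + m + 1 = n) :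
    gaussSum ((quadraticChar K).ringHomComp (Int.castRingHom ℂ))
        (ψ.compAddMonoidHom l.toAddMonoidHom) * monicCharSum F θ k =
      (Fintype.card F : ℂ) ^ k * (polyCharSum F θ m +
        (∑ c : F, ψ c * quadraticChar K (algebraMap F K c)) * monicCharSum F θ m) := by
  set χ := (quadraticChar K).ringHomComp (Int.castRingHom ℂ) with hχ
  set Ψ := ψ.compAddMonoidHom l.toAddMonoidHom with hΨ
  have hχa : ∀ a, χ a = ((quadraticChar K a : ℤ) : ℂ) := fun a => rfl
  have hΨa : ∀ a, Ψ a = ψ (l a) := fun a => rfl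
  have hshift : ∀ b : K, gaussSum χ Ψ * χ b = ∑ a, χ a * Ψ (a * b) := by
    intro b
    rcases eq_or_ne b 0 with rfl | hb
    · have := quadraticChar_sum_zero hK
      simp only [mul_zero, AddChar.map_zero_eq_one, mul_one, hχa, MulChar.map_zero, Int.cast_zero,
        ← Int.cast_sum, this]
    · have h2 : χ b * χ b = 1 := by
        rw [hχa, ← Int.cast_mul, ← map_mul, ← sq, quadraticChar_sq_one' hb, Int.cast_one]
      have h3 := gaussSum_mulShift χ Ψ (Units.mk0 b hb)
      rw [Units.val_mk0] at h3
      rw [← h3, mul_right_comm, h2, one_mul, gaussSum]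
      simp only [AddChar.mulShift_apply, mul_comm b]
  have hinner : ∀ a : K, (∑ w : Fin k → F, Ψ (a * aeval θ (polyOfFin k w))) =
      if ∀ w : Fin k → F, l (a * aeval θ (polyOfFin k w)) = 0 then (Fintype.card F : ℂ) ^ k
        else 0 := by
    intro a
    split_ifs with h
    · simp [hΨa, h]
    · push Not at h
      obtain ⟨w, hw⟩ := h
      have hne : ψ.compAddMonoidHom (l ∘ₗ LinearMap.mulLeft F a ∘ₗ (aeval θ).toLinearMap ∘ₗ
          polyOfFin k).toAddMonoidHom ≠ 1 := by
        obtain ⟨x, hx⟩ := AddChar.ne_one_iff.1 hψ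
        refine AddChar.ne_one_iff.2 ⟨(x / l (a * aeval θ (polyOfFin k w))) • w, ?_⟩
        have : (l ∘ₗ LinearMap.mulLeft F a ∘ₗ (aeval θ).toLinearMap ∘ₗ polyOfFin k)
            ((x / l (a * aeval θ (polyOfFin k w))) • w) = x := by
          rw [map_smul, smul_eq_mul]
          exact div_mul_cancel₀ x hw
        simpa [this] using hx
      exact AddChar.sum_eq_zero_of_ne_one hne
  have h1 : gaussSum χ Ψ * monicCharSum F θ k = ∑ a : K, χ a * Ψ (a * θ ^ k) *
      ∑ w : Fin k → F, Ψ (a * aeval θ (polyOfFin k w)) := by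
    rw [monicCharSum, Int.cast_sum, Finset.mul_sum]
    simp only [← hχa, hshift, Finset.mul_sum]
    rw [Finset.sum_comm]
    refine Finset.sum_congr rfl fun a _ => Finset.sum_congr rfl fun w _ => ?_
    rw [monicOfFin, map_add, mul_add, AddChar.map_add_eq_mul, map_pow, aeval_X, mul_assoc]
  rw [h1, ← one_mul ((polyCharSum F θ m : ℤ) : ℂ),
    ← AddChar.map_zero_eq_one ψ, ← sum_mul_quadraticChar_aeval_snoc θ m ψ, Finset.mul_sum]
  symm
  refine Finset.sum_of_injOn (fun v => aeval θ (polyOfFin (m + 1) v)) ?_ (by simp) ?_ ?_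
  · intro v _ v' _ h
    refine polyOfFin_injective (m + 1) (sub_eq_zero.1 (hinj _ ?_ ?_))
    · rw [← map_sub]
      exact (degree_polyOfFin_lt _).trans_le (by exact_mod_cast (by omega : m + 1 ≤ n))
    · rw [map_sub, sub_eq_zero]
      exact h
  · intro a _ ha
    obtain ⟨g, hg, rfl⟩ := hθ a
    rw [hinner, if_neg, mul_zero]
    intro h
    apply ha
    have hgm : g.degree < (m + 1 : ℕ) := by
      by_contra hgm
      have hg0 : g ≠ 0 := by
        rintro rfl
        simp at hgm
      rw [← natDegree_lt_iff_degree_lt hg0] at hg hgm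
      obtain ⟨w, hw⟩ := exists_polyOfFin_eq (R := F) (k := k) (g := X ^ (n - 1 - g.natDegree)) (by
        rw [degree_X_pow]
        exact_mod_cast (by omega : n - 1 - g.natDegree < k))
      have := h w
      rw [hw, ← map_mul, hl _ (by
        rw [degree_mul, degree_X_pow, degree_eq_natDegree hg0]
        exact_mod_cast (by omega : g.natDegree + (n - 1 - g.natDegree) < n)), coeff_mul_X_pow',
        if_pos (by omega), (by omega : n - 1 - (n - 1 - g.natDegree) = g.natDegree)] at this
      exact hg0 (leadingCoeff_eq_zero.1 this)
    obtain ⟨v, hv⟩ := exists_polyOfFin_eq hgm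
    exact ⟨v, by simp, by simp [hv]⟩
  · intro v _
    have hdeg : ∀ d : ℕ, ∀ f : F[X], f.degree < d → (polyOfFin (m + 1) v * f).degree < (m + d : ℕ) := by
      intro d f hf
      rcases eq_or_ne (polyOfFin (m + 1) v) 0 with h0 | h0
      · rw [h0, zero_mul, degree_zero]
        exact WithBot.bot_lt_coe _
      rcases eq_or_ne f 0 with h0' | h0'
      · rw [h0', mul_zero, degree_zero]
        exact WithBot.bot_lt_coe _
      have h3 := degree_polyOfFin_lt v
      rw [← natDegree_lt_iff_degree_lt h0] at h3
      rw [← natDegree_lt_iff_degree_lt h0'] at hf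
      rw [← natDegree_lt_iff_degree_lt (mul_ne_zero h0 h0'), natDegree_mul h0 h0']
      omega
    rw [hinner, if_pos]
    · have h2 : l (aeval θ (polyOfFin (m + 1) v) * θ ^ k) = v (Fin.last m) := by
        have h3 : aeval θ (polyOfFin (m + 1) v) * θ ^ k = aeval θ (polyOfFin (m + 1) v * X ^ k) := by
          simp
        rw [h3, hl, coeff_mul_X_pow', if_pos (by omega), (by omega : n - 1 - k = m),
          polyOfFin_apply, finsetSum_coeff, Fin.sum_univ_castSucc]
        · simp [coeff_monomial, (Fin.is_lt _).ne]
        · refine (hdeg (k + 1) _ ?_).trans_le (by exact_mod_cast (by omega : m + (k + 1) ≤ n))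
          rw [degree_X_pow]
          exact_mod_cast k.lt_succ_self
      rw [hΨa, h2, hχa]
      ring
    · intro w
      have h3 := hdeg k _ (degree_polyOfFin_lt w)
      rw [← map_mul, hl]
      · exact coeff_eq_zero_of_degree_lt (h3.trans_le (by exact_mod_cast (by omega : m + k ≤ n - 1)))
      · exact h3.trans_le (by exact_mod_cast (by omega : m + k ≤ n))

end QuadraticCharSum

theorem degree_X_pow_add {R : Type*} [Ring R] [Nontrivial R] {n : ℕ} {p : R[X]} (hp : p.degree < n) :
    (X ^ n + p).degree = (n : WithBot ℕ) := by
  rw [degree_add_eq_left_of_degree_lt (by rwa [degree_X_pow]), degree_X_pow]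

section PrimitiveElement

variable {F K : Type*} [Field F] [Fintype F] [Field K] [Fintype K] [Algebra F K]

theorem quadraticChar_algebraMap (hF : ringChar F ≠ 2) (c : F) :
    quadraticChar K (algebraMap F K c) = quadraticChar F c ^ Module.finrank F K := by
  have hK : ringChar K ≠ 2 := by rwa [← Algebra.ringChar_eq F K]
  have hmem : ∀ m : ℕ, (quadraticChar F c ^ m : ℤ) ∈ ({0, 1, -1} : Set ℤ) := by
    intro m
    rcases quadraticChar_isQuadratic F c with h | h | h <;> rw [h]
    · rcases m with _ | m <;> simp
    · simp
    · rcases neg_one_pow_eq_or ℤ m with h | h <;> simp [h]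
  have hpow : ∀ m : ℕ, c ^ (Fintype.card F ^ m / 2) = (c ^ (Fintype.card F / 2)) ^ m := by
    intro m
    induction m with
    | zero => simp
    | succ m ih =>
      have h1 := FiniteField.odd_card_of_char_ne_two hF
      have h2 : Fintype.card F ^ (m + 1) / 2 =
          Fintype.card F ^ m / 2 * Fintype.card F + Fintype.card F / 2 := by
        have h3 : Fintype.card F ^ m % 2 = 1 := by rw [Nat.pow_mod, h1, one_pow, Nat.one_mod]
        have h4 : Fintype.card F ^ (m + 1) =
            2 * (Fintype.card F ^ m / 2 * Fintype.card F) + Fintype.card F := by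
          conv_lhs => rw [pow_succ, ← Nat.div_add_mod (Fintype.card F ^ m) 2, h3]
          ring
        omega
      rw [h2, pow_add, pow_mul, FiniteField.pow_card, ih, pow_succ]
  refine Int.cast_injOn_of_ringChar_ne_two hK (quadraticChar_isQuadratic K _) (hmem _) ?_
  rw [quadraticChar_eq_pow_of_char_ne_two' hK, Module.card_eq_pow_finrank (K := F) (V := K),
    ← map_pow, hpow, ← quadraticChar_eq_pow_of_char_ne_two' hF]
  simp

theorem sum_quadraticChar_algebraMap (hF : ringChar F ≠ 2) :
    ∑ c : F, quadraticChar K (algebraMap F K c) =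
      if Even (Module.finrank F K) then (Fintype.card F : ℤ) - 1 else 0 := by
  have hn : Module.finrank F K ≠ 0 := Module.finrank_pos.ne'
  simp only [quadraticChar_algebraMap hF]
  split_ifs with h
  · have : ∀ c : F, quadraticChar F c ^ Module.finrank F K = 1 - if c = 0 then 1 else 0 := by
      intro c
      split_ifs with hc
      · rw [hc, MulChar.map_zero, zero_pow hn, sub_self]
      · obtain ⟨r, hr⟩ := even_iff_exists_two_mul.1 h
        rw [hr, pow_mul, quadraticChar_sq_one hc, one_pow, sub_zero]
    rw [Finset.sum_congr rfl fun c _ => this c]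
    simp
  · have : ∀ c : F, quadraticChar F c ^ Module.finrank F K = quadraticChar F c := by
      intro c
      rw [← MulChar.pow_apply' _ hn, (quadraticChar_isQuadratic F).pow_odd (Nat.not_even_iff_odd.1 h)]
    simp only [this, quadraticChar_sum_zero hF]

omit [Fintype F] in
theorem exists_powerBasis_gen_eq {θ : K} (hθ : (minpoly F θ).natDegree = Module.finrank F K) :
    ∃ pb : PowerBasis F K, pb.gen = θ := by
  have hi : IsIntegral F θ := Algebra.IsIntegral.isIntegral θ
  have h := (Field.primitive_element_iff_minpoly_natDegree_eq F θ).2 hθ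
  have htop : Algebra.adjoin F {θ} = ⊤ := by
    rw [← IntermediateField.adjoin_simple_toSubalgebra_of_isAlgebraic hi.isAlgebraic, h,
      IntermediateField.top_toSubalgebra]
  exact ⟨PowerBasis.ofAdjoinEqTop hi htop, PowerBasis.ofAdjoinEqTop_gen hi htop⟩

theorem aeval_derivative_minpoly_ne_zero (θ : K) :
    aeval θ (derivative (minpoly F θ)) ≠ 0 :=
  (Algebra.IsSeparable.isSeparable F θ).aeval_derivative_ne_zero (minpoly.aeval F θ)

theorem trace_aeval_div_derivative {θ : K} (hθ : (minpoly F θ).natDegree = Module.finrank F K)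
    {g : F[X]} (hg : g.degree < Module.finrank F K) :
    Algebra.trace F K (aeval θ g / aeval θ (derivative (minpoly F θ))) =
      g.coeff (Module.finrank F K - 1) := by
  obtain ⟨pb, rfl⟩ := exists_powerBasis_gen_eq hθ
  have hn : 0 < Module.finrank F K := Module.finrank_pos
  have hdim : pb.dim = Module.finrank F K := pb.finrank.symm
  let i : Fin pb.dim := ⟨Module.finrank F K - 1, by omega⟩
  have hi := Algebra.IsIntegral.isIntegral (R := F) pb.gen
  have hdual : pb.basis.traceDual i = 1 / aeval pb.gen (derivative (minpoly F pb.gen)) := by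
    rw [Module.Basis.traceDual_powerBasis_eq]
    congr 1
    have := natDegree_minpolyDiv_succ hi
    rw [← (minpolyDiv_monic hi).coeff_natDegree]
    congr 1
    simp only [i]
    omega
  rcases eq_or_ne g 0 with rfl | hg0
  · simp
  rw [aeval_eq_sum_range' ((natDegree_lt_iff_degree_lt hg0).2 hg), Finset.sum_div, map_sum,
    Finset.sum_eq_single (Module.finrank F K - 1)]
  · have h1 := Module.Basis.trace_traceDual_mul pb.basis i i
    rw [if_pos rfl, hdual, PowerBasis.coe_basis] at h1
    rw [Algebra.smul_def, mul_div_assoc, ← Algebra.smul_def, map_smul, div_eq_mul_one_div,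
      mul_comm (pb.gen ^ _), h1, smul_eq_mul, mul_one]
  · intro j hj hji
    have hj' : j < pb.dim := by
      rw [hdim]
      exact Finset.mem_range.1 hj
    have h1 := Module.Basis.trace_traceDual_mul pb.basis i ⟨j, hj'⟩
    rw [if_neg (fun h => hji (congrArg Fin.val h)), hdual, PowerBasis.coe_basis] at h1
    rw [Algebra.smul_def, mul_div_assoc, ← Algebra.smul_def, map_smul, div_eq_mul_one_div,
      mul_comm (pb.gen ^ _), h1, smul_zero]
  · intro h
    exact absurd (Finset.mem_range.2 (by omega)) h

omit [Fintype F] in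
theorem exists_aeval_eq {θ : K} (hθ : (minpoly F θ).natDegree = Module.finrank F K) (a : K) :
    ∃ g : F[X], g.degree < Module.finrank F K ∧ aeval θ g = a := by
  obtain ⟨pb, rfl⟩ := exists_powerBasis_gen_eq hθ
  obtain ⟨f, hf, rfl⟩ := pb.exists_eq_aeval a
  exact ⟨f, (degree_le_natDegree).trans_lt (by rw [pb.finrank]; exact_mod_cast hf), rfl⟩

omit [Fintype F] [Fintype K] in
theorem eq_zero_of_aeval_eq_zero {θ : K} (hθ : (minpoly F θ).natDegree = Module.finrank F K)
    {g : F[X]} (hg : g.degree < Module.finrank F K) (h : aeval θ g = 0) : g = 0 := by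
  by_contra h0
  have h1 := natDegree_le_of_dvd (minpoly.dvd F θ h) h0
  rw [← natDegree_lt_iff_degree_lt h0] at hg
  omega

theorem prod_eq_one_of_trace_eq_one {ι : Type*} [Fintype ι] (hF : ringChar F ≠ 2) {b : ι → K}
    (hb : Function.Injective b) (htr : ∀ i, Algebra.trace F K (b i) = 1)
    (hι : Fintype.card ι = Fintype.card F ^ (Module.finrank F K - 1)) : ∏ i, b i = 1 := by
  obtain ⟨r, hr⟩ := Nat.exists_eq_succ_of_ne_zero (Module.finrank_pos (R := F) (M := K)).ne'
  rw [hr, Nat.succ_sub_one] at hι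
  set q := Fintype.card F with hq
  have hq1 : 1 < q := Fintype.one_lt_card
  have hlow : (∑ i ∈ Finset.range r, X ^ q ^ i - 1 : K[X]).degree < (q ^ r : ℕ) := by
    rw [← mem_degreeLT]
    refine Submodule.sub_mem _ (Submodule.sum_mem _ fun i hi => ?_) ?_
    · rw [mem_degreeLT, degree_X_pow]
      exact_mod_cast Nat.pow_lt_pow_right hq1 (Finset.mem_range.1 hi)
    · rw [mem_degreeLT, degree_one]
      exact_mod_cast (by positivity : 0 < q ^ r)
  have hmon := monic_X_pow_add hlow
  have hdeg : (X ^ q ^ r + (∑ i ∈ Finset.range r, X ^ q ^ i - 1) : K[X]).natDegree = q ^ r :=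
    natDegree_eq_of_degree_eq_some (degree_X_pow_add hlow)
  have heq := eq_of_monic_of_dvd_of_natDegree_le (p := ∏ i, (X - C (b i)))
    (monic_prod_of_monic _ _ fun i _ => monic_X_sub_C _) hmon
    (Finset.prod_dvd_of_coprime ((pairwise_coprime_X_sub_C hb).set_pairwise _) fun i _ => by
      rw [dvd_iff_isRoot, IsRoot]
      have := FiniteField.algebraMap_trace_eq_sum_pow F K (b i)
      rw [htr, map_one, hr, Finset.sum_range_succ, Nat.card_eq_fintype_card] at this
      simp only [eval_add, eval_sub, eval_finsetSum, eval_pow, eval_X, eval_one]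
      linear_combination -this)
    (by rw [hdeg, natDegree_prod_of_monic _ _ fun i _ => monic_X_sub_C _]; simp [hι])
  have h0 := congrArg (eval 0) heq
  have hq_odd : Odd q := Nat.odd_iff.2 (FiniteField.odd_card_of_char_ne_two hF)
  have hz : ∀ i, (0 : K) ^ q ^ i = 0 := fun i => zero_pow (by positivity)
  simp only [eval_add, eval_sub, eval_finsetSum, eval_pow, eval_X, eval_one, eval_prod, eval_C, hz,
    Finset.sum_const_zero, zero_add, zero_sub, Finset.prod_neg, Finset.card_univ, hι,
    (hq_odd.pow (n := r)).neg_one_pow] at h0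
  linear_combination h0

theorem four_dvd_sum_sub {ι : Type*} (s : Finset ι) {ε : ι → ℤ} (hε : ∀ i, ε i = 1 ∨ ε i = -1) :
    4 ∣ ∑ i ∈ s, ε i - (s.card - 1 + ∏ i ∈ s, ε i) := by
  induction s using Finset.induction_on with
  | empty => simp
  | insert a s ha ih =>
    rw [Finset.sum_insert ha, Finset.prod_insert ha, Finset.card_insert_of_notMem ha]
    have hprod : ∏ i ∈ s, ε i = 1 ∨ ∏ i ∈ s, ε i = -1 := by
      rw [← Int.isUnit_iff]
      exact (Finset.prod_induction ε IsUnit (fun _ _ => IsUnit.mul) isUnit_one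
        fun i _ => Int.isUnit_iff.2 (hε i))
    push_cast
    rcases hε a with h | h <;> rcases hprod with h' | h' <;> rw [h] <;> rw [h'] at ih ⊢ <;> omega

theorem four_dvd_monicCharSum_sub (hF : ringChar F ≠ 2) {θ : K}
    (hθ : (minpoly F θ).natDegree = Module.finrank F K) :
    4 ∣ monicCharSum F θ (Module.finrank F K - 1) - ((Fintype.card F : ℤ) ^ (Module.finrank F K - 1)
      - 1 + quadraticChar K (aeval θ (derivative (minpoly F θ)))) := by
  set n := Module.finrank F K with hn
  have hn0 : 0 < n := Module.finrank_pos
  set D := aeval θ (derivative (minpoly F θ)) with hD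
  have hD0 : D ≠ 0 := aeval_derivative_minpoly_ne_zero θ
  have hdeg : ∀ w : Fin (n - 1) → F, (monicOfFin (n - 1) w).degree = (n - 1 : ℕ) := fun w =>
    degree_X_pow_add (degree_polyOfFin_lt w)
  have hlt : ∀ w : Fin (n - 1) → F, (monicOfFin (n - 1) w).degree < n := fun w => by
    rw [hdeg]
    exact_mod_cast (by omega : n - 1 < n)
  have hne : ∀ w : Fin (n - 1) → F, aeval θ (monicOfFin (n - 1) w) ≠ 0 := fun w h => by
    have := hdeg w
    rw [eq_zero_of_aeval_eq_zero hθ (hlt w) h, degree_zero] at this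
    exact WithBot.bot_ne_coe this
  have hprod : ∏ w : Fin (n - 1) → F, aeval θ (monicOfFin (n - 1) w) / D = 1 := by
    refine prod_eq_one_of_trace_eq_one hF ?_ ?_ (by simp [hn])
    · intro w w' h
      have h2 : aeval θ (monicOfFin (n - 1) w) = aeval θ (monicOfFin (n - 1) w') := by
        simpa [hD0] using h
      simp only [monicOfFin, map_add, add_right_inj] at h2
      refine polyOfFin_injective _ (sub_eq_zero.1 (eq_zero_of_aeval_eq_zero hθ ?_ ?_))
      · rw [← map_sub]
        exact (degree_polyOfFin_lt _).trans_le (by exact_mod_cast (n.sub_le 1))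
      · rw [map_sub, h2, sub_self]
    · intro w
      rw [trace_aeval_div_derivative hθ (hlt w), ← hn, monicOfFin, coeff_add, coeff_X_pow_self,
        coeff_polyOfFin_self, add_zero]
  rw [Finset.prod_div_distrib, Finset.prod_const, div_eq_one_iff_eq (pow_ne_zero _ hD0)] at hprod
  have hchi := congrArg (quadraticChar K) hprod
  have hodd : Odd (Finset.univ : Finset (Fin (n - 1) → F)).card := by
    rw [Finset.card_univ, Fintype.card_fun, Fintype.card_fin]
    exact Odd.pow (Nat.odd_iff.2 (FiniteField.odd_card_of_char_ne_two hF))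
  rw [map_prod, map_pow, ← MulChar.pow_apply' _ hodd.pos.ne',
    (quadraticChar_isQuadratic K).pow_odd hodd] at hchi
  have := four_dvd_sum_sub Finset.univ fun w => quadraticChar_dichotomy (hne w)
  rw [hchi] at this
  simpa [monicCharSum] using this

theorem pow_card_pow_injOn {θ : K} (hθ : (minpoly F θ).natDegree = Module.finrank F K) :
    Function.Injective fun i : Fin (Module.finrank F K) => θ ^ Fintype.card F ^ (i : ℕ) := by
  obtain ⟨pb, rfl⟩ := exists_powerBasis_gen_eq hθ
  intro i j hij
  refine (FiniteField.bijective_frobeniusAlgEquivOfAlgebraic_pow F K).injective ?_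
  refine AlgEquiv.coe_toAlgHom_injective (pb.algHom_ext ?_)
  simpa [AlgEquiv.coe_pow, FiniteField.coe_frobeniusAlgEquivOfAlgebraic_iterate] using hij

theorem aeval_pow_card_pow (P : F[X]) (θ : K) (i : ℕ) :
    aeval (θ ^ Fintype.card F ^ i) P = aeval θ P ^ Fintype.card F ^ i := by
  have h : ∀ x : K, (FiniteField.frobeniusAlgEquivOfAlgebraic F K ^ i) x = x ^ Fintype.card F ^ i :=
    fun x => by simp [AlgEquiv.coe_pow, FiniteField.coe_frobeniusAlgEquivOfAlgebraic_iterate]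
  rw [← h, ← h, aeval_algHom_apply]

theorem aeval_derivative_minpoly_eq_prod {θ : K}
    (hθ : (minpoly F θ).natDegree = Module.finrank F K) :
    aeval θ (derivative (minpoly F θ)) =
      ∏ i ∈ Finset.range (Module.finrank F K - 1), (θ - θ ^ Fintype.card F ^ (i + 1)) := by
  have hi := Algebra.IsIntegral.isIntegral (R := F) θ
  have heq := eq_of_monic_of_dvd_of_natDegree_le (q := (minpoly F θ).map (algebraMap F K))
    (p := ∏ i : Fin (Module.finrank F K), (X - C (θ ^ Fintype.card F ^ (i : ℕ))))
    (monic_prod_of_monic _ _ fun i _ => monic_X_sub_C _) ((minpoly.monic hi).map _)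
    (Finset.prod_dvd_of_coprime
      ((pairwise_coprime_X_sub_C (pow_card_pow_injOn hθ)).set_pairwise _) fun i _ => by
        rw [dvd_iff_isRoot, IsRoot, eval_map_algebraMap, aeval_pow_card_pow, minpoly.aeval,
          zero_pow (pow_ne_zero _ Fintype.card_ne_zero)])
    (by rw [natDegree_prod_of_monic _ _ fun i _ => monic_X_sub_C _]; simp only [natDegree_X_sub_C]; simp [hθ])
  obtain ⟨r, hr⟩ := Nat.exists_eq_succ_of_ne_zero (Module.finrank_pos (R := F) (M := K)).ne'
  rw [Fin.prod_univ_eq_prod_range (fun i => X - C (θ ^ Fintype.card F ^ i)), hr,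
    Finset.prod_range_succ'] at heq
  rw [← eval_map_algebraMap, ← derivative_map, heq, hr, Nat.succ_sub_one]
  simp [eval_prod]

theorem quadraticChar_pow_of_odd (x : K) {m : ℕ} (hm : Odd m) :
    quadraticChar K (x ^ m) = quadraticChar K x := by
  rw [map_pow, ← MulChar.pow_apply' _ hm.pos.ne', (quadraticChar_isQuadratic K).pow_odd hm]

theorem sub_pow_card_pow (x y : K) (m : ℕ) :
    (x - y) ^ Fintype.card F ^ m = x ^ Fintype.card F ^ m - y ^ Fintype.card F ^ m := by
  have h : ∀ x : K, (FiniteField.frobeniusAlgEquivOfAlgebraic F K ^ m) x = x ^ Fintype.card F ^ m :=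
    fun x => by simp [AlgEquiv.coe_pow, FiniteField.coe_frobeniusAlgEquivOfAlgebraic_iterate]
  rw [← h, map_sub, h, h]

theorem sub_pow_card_pow_pow (θ : K) {i j : ℕ} (hij : i + j = Module.finrank F K) :
    (θ - θ ^ Fintype.card F ^ i) ^ Fintype.card F ^ j = -(θ - θ ^ Fintype.card F ^ j) := by
  rw [sub_pow_card_pow, ← pow_mul, ← pow_add, hij, ← Module.card_eq_pow_finrank (K := F) (V := K),
    FiniteField.pow_card]
  ring

theorem quadraticChar_sub_pow_mul (hF : ringChar F ≠ 2) {θ : K}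
    (hθ : (minpoly F θ).natDegree = Module.finrank F K) {i j : ℕ} (hi : i ≠ 0) (hj : j ≠ 0)
    (hij : i + j = Module.finrank F K) :
    quadraticChar K (θ - θ ^ Fintype.card F ^ i) * quadraticChar K (θ - θ ^ Fintype.card F ^ j) =
      quadraticChar K (-1) := by
  have hne : θ - θ ^ Fintype.card F ^ j ≠ 0 := by
    intro h
    have := @pow_card_pow_injOn F K _ _ _ _ _ θ hθ ⟨0, by omega⟩ ⟨j, by omega⟩
      (by simpa using sub_eq_zero.1 h)
    exact hj (congrArg Fin.val this).symm
  have hodd : Odd (Fintype.card F ^ j) :=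
    Odd.pow (Nat.odd_iff.2 (FiniteField.odd_card_of_char_ne_two hF))
  rw [← quadraticChar_pow_of_odd (θ - θ ^ Fintype.card F ^ i) hodd, sub_pow_card_pow_pow θ hij,
    neg_eq_neg_one_mul, map_mul, mul_assoc, ← sq, quadraticChar_sq_one hne, mul_one]

theorem quadraticChar_derivative_minpoly_of_odd (hF : ringChar F ≠ 2) {θ : K}
    (hθ : (minpoly F θ).natDegree = Module.finrank F K) {k : ℕ}
    (hk : Module.finrank F K = 2 * k + 1) :
    quadraticChar K (aeval θ (derivative (minpoly F θ))) = quadraticChar K (-1) ^ k := by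
  rw [aeval_derivative_minpoly_eq_prod hθ, map_prod, hk, Nat.add_sub_cancel, two_mul,
    Finset.prod_range_add, ← Finset.prod_range_reflect (fun x => quadraticChar K
      (θ - θ ^ Fintype.card F ^ (k + x + 1))), ← Finset.prod_mul_distrib,
    Finset.prod_congr rfl fun j hj => quadraticChar_sub_pow_mul hF hθ ?_ ?_ ?_, Finset.prod_const,
    Finset.card_range]
  · omega
  · omega
  · have := Finset.mem_range.1 hj
    omega

theorem quadraticChar_derivative_minpoly_of_even (hF : ringChar F ≠ 2) {θ : K}
    (hθ : (minpoly F θ).natDegree = Module.finrank F K) {k : ℕ}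
    (hk : Module.finrank F K = 2 * (k + 1)) :
    quadraticChar K (aeval θ (derivative (minpoly F θ))) =
      (-1) ^ ((Fintype.card F ^ (k + 1) + 1) / 2) := by
  have hK : ringChar K ≠ 2 := by rwa [← Algebra.ringChar_eq F K]
  have hneg : quadraticChar K (-1) = 1 := by
    have := quadraticChar_algebraMap (K := K) hF (-1)
    rw [map_neg, map_one, hk, pow_mul, quadraticChar_sq_one (by simp), one_pow] at this
    exact this
  rw [aeval_derivative_minpoly_eq_prod hθ, map_prod, hk,
    (by omega : 2 * (k + 1) - 1 = k + 1 + k), Finset.prod_range_add, Finset.prod_range_succ,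
    mul_right_comm, ← Finset.prod_range_reflect (fun x => quadraticChar K
      (θ - θ ^ Fintype.card F ^ (k + 1 + x + 1))), ← Finset.prod_mul_distrib,
    Finset.prod_congr rfl fun j hj => quadraticChar_sub_pow_mul hF hθ ?_ ?_ ?_, Finset.prod_const,
    Finset.card_range, hneg, one_pow, one_mul]
  · set d := θ - θ ^ Fintype.card F ^ (k + 1) with hd
    have hd1 : d ^ Fintype.card F ^ (k + 1) = -d := sub_pow_card_pow_pow θ (by omega)
    have hd0 : d ≠ 0 := by
      intro h
      have := @pow_card_pow_injOn F K _ _ _ _ _ θ hθ ⟨0, by omega⟩ ⟨k + 1, by omega⟩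
        (by simpa using sub_eq_zero.1 h)
      simp at this
    have hmem : ((-1) ^ ((Fintype.card F ^ (k + 1) + 1) / 2) : ℤ) ∈ ({0, 1, -1} : Set ℤ) := by
      rcases neg_one_pow_eq_or ℤ ((Fintype.card F ^ (k + 1) + 1) / 2) with h | h <;> simp [h]
    refine Int.cast_injOn_of_ringChar_ne_two hK (quadraticChar_isQuadratic K _) hmem ?_
    have hodd : Odd (Fintype.card F ^ (k + 1)) :=
      Odd.pow (Nat.odd_iff.2 (FiniteField.odd_card_of_char_ne_two hF))
    obtain ⟨r, hr⟩ := hodd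
    have hcard : Fintype.card K / 2 = 2 * r * (r + 1) := by
      rw [Module.card_eq_pow_finrank (K := F) (V := K), hk, mul_comm 2, pow_mul, hr]
      have : (2 * r + 1) ^ 2 = 2 * (2 * r * (r + 1)) + 1 := by ring
      omega
    rw [hr, pow_succ, ← neg_one_mul, mul_left_inj' hd0] at hd1
    rw [quadraticChar_eq_pow_of_char_ne_two' hK, hcard, pow_mul, hd1, hr,
      (by omega : (2 * r + 1 + 1) / 2 = r + 1)]
    simp
  · omega
  · omega
  · have := Finset.mem_range.1 hj
    omega

theorem ringHomComp_quadraticChar_ne_one (hK : ringChar K ≠ 2) :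
    (quadraticChar K).ringHomComp (Int.castRingHom ℂ) ≠ 1 :=
  (MulChar.ringHomComp_ne_one_iff Int.cast_injective).2 (quadraticChar_ne_one hK)

theorem exists_gaussSum_relations (hF : ringChar F ≠ 2) {θ : K}
    (hθ : (minpoly F θ).natDegree = Module.finrank F K) :
    ∃ G g : ℂ, G ^ 2 = quadraticChar K (-1) * (Fintype.card F : ℂ) ^ Module.finrank F K ∧
      (Even (Module.finrank F K) → g = -1) ∧
      (Odd (Module.finrank F K) → g ^ 2 = quadraticChar K (-1) * (Fintype.card F : ℂ)) ∧
      ∀ j m, j + m + 1 = Module.finrank F K → G * monicCharSum F θ j =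
        (Fintype.card F : ℂ) ^ j * (polyCharSum F θ m + g * monicCharSum F θ m) := by
  have hK : ringChar K ≠ 2 := by rwa [← Algebra.ringChar_eq F K]
  obtain ⟨ψ, hψ1⟩ := AddChar.exists_apply_ne_zero.2 (one_ne_zero (α := F))
  have hψ : ψ ≠ 1 := AddChar.ne_one_iff.2 ⟨1, hψ1⟩
  let l : K →ₗ[F] F := Algebra.trace F K ∘ₗ
    LinearMap.mulRight F (aeval θ (derivative (minpoly F θ)))⁻¹
  have hl : ∀ g : F[X], g.degree < Module.finrank F K →
      l (aeval θ g) = g.coeff (Module.finrank F K - 1) := fun g hg => by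
    rw [← trace_aeval_div_derivative hθ hg, div_eq_mul_inv]
    rfl
  refine ⟨_, _, ?_, ?_, ?_, fun j m hjm => gaussSum_mul_monicCharSum hl (exists_aeval_eq hθ)
    (fun g => eq_zero_of_aeval_eq_zero hθ) hψ hK hjm⟩
  · rw [gaussSum_sq]
    · rw [Module.card_eq_pow_finrank (K := F) (V := K)]
      push_cast
      rfl
    · exact ringHomComp_quadraticChar_ne_one hK
    · exact (quadraticChar_isQuadratic K).comp _
    · refine AddChar.IsPrimitive.of_ne_one (AddChar.ne_one_iff.2 ?_)
      refine ⟨aeval θ (X ^ (Module.finrank F K - 1) : F[X]), ?_⟩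
      have : l (aeval θ (X ^ (Module.finrank F K - 1) : F[X])) = 1 := by
        rw [hl _ (by
          rw [degree_X_pow]
          exact_mod_cast Nat.sub_lt Module.finrank_pos one_pos), coeff_X_pow_self]
      change ψ (l _) ≠ 1
      rwa [this]
  · intro h
    have h1 : ∀ c : F, ψ c * (quadraticChar K (algebraMap F K c) : ℤ) =
        ψ c - if c = 0 then 1 else 0 := by
      intro c
      rw [quadraticChar_algebraMap hF]
      split_ifs with hc
      · rw [hc, MulChar.map_zero, zero_pow Module.finrank_pos.ne', AddChar.map_zero_eq_one]
        simp
      · obtain ⟨r, hr⟩ := even_iff_exists_two_mul.1 h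
        rw [hr, pow_mul, quadraticChar_sq_one hc, one_pow]
        simp
    rw [Finset.sum_congr rfl fun c _ => h1 c, Finset.sum_sub_distrib,
      AddChar.sum_eq_zero_of_ne_one hψ]
    simp
  · intro h
    have h1 : ∀ c : F, quadraticChar K (algebraMap F K c) = quadraticChar F c := by
      intro c
      rw [quadraticChar_algebraMap hF, ← map_pow, quadraticChar_pow_of_odd _ h]
    have h2 := gaussSum_sq (ringHomComp_quadraticChar_ne_one hF)
      ((quadraticChar_isQuadratic F).comp (Int.castRingHom ℂ))
      (AddChar.IsPrimitive.of_ne_one hψ)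
    rw [← map_one (algebraMap F K), ← map_neg, h1]
    refine Eq.trans ?_ h2
    rw [gaussSum]
    congr 1
    refine Finset.sum_congr rfl fun c _ => ?_
    rw [h1, mul_comm]
    rfl

theorem quadraticChar_neg_one_ne_zero : quadraticChar K (-1) ≠ 0 := by
  rw [Ne, quadraticChar_eq_zero_iff]
  simp

theorem monicCharSum_zero (θ : K) : monicCharSum F θ 0 = 1 := by
  simp [monicCharSum, monicOfFin, polyOfFin_apply]

theorem polyCharSum_eq_ite (hF : ringChar F ≠ 2) (θ : K) (k : ℕ) :
    polyCharSum F θ k = if Even (Module.finrank F K) then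
      ((Fintype.card F : ℤ) - 1) * ∑ j ∈ Finset.range k, monicCharSum F θ j else 0 := by
  rw [polyCharSum_eq, sum_quadraticChar_algebraMap hF]
  split_ifs <;> simp

theorem four_dvd_pow_mul_sub {q : ℤ} (hq : Odd q) (m : ℕ) : 4 ∣ q ^ (2 * m) - 1 := by
  obtain ⟨r, rfl⟩ := hq
  rw [pow_mul]
  refine dvd_trans ?_ (sub_one_dvd_pow_sub_one _ m)
  exact ⟨r ^ 2 + r, by ring⟩

theorem monicCharSum_finrank_sub_one_of_odd (hF : ringChar F ≠ 2) {θ : K}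
    (hθ : (minpoly F θ).natDegree = Module.finrank F K) {k : ℕ}
    (hk : Module.finrank F K = 2 * k + 1) :
    monicCharSum F θ (2 * k) = (Fintype.card F : ℤ) ^ k := by
  have hK : ringChar K ≠ 2 := by rwa [← Algebra.ringChar_eq F K]
  obtain ⟨G, g, hG, -, hg, hrel⟩ := exists_gaussSum_relations hF hθ
  have hn_odd : Odd (Module.finrank F K) := ⟨k, hk⟩
  have hq0 : (Fintype.card F : ℂ) ≠ 0 := by simp
  have hχ0 : ((quadraticChar K (-1) : ℤ) : ℂ) ≠ 0 :=
    Int.cast_ne_zero.2 quadraticChar_neg_one_ne_zero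
  have h1 := hrel (2 * k) 0 (by omega)
  rw [polyCharSum_eq_ite hF, if_neg (Nat.not_even_iff_odd.2 hn_odd), monicCharSum_zero] at h1
  have h2 : (monicCharSum F θ (2 * k) : ℂ) ^ 2 = ((Fintype.card F : ℂ) ^ k) ^ 2 := by
    have h3 := congrArg (· ^ 2) h1
    simp only [mul_pow, hG, Int.cast_zero, zero_add, Int.cast_one, mul_one, hg hn_odd, hk] at h3
    have h4 : ((quadraticChar K (-1) : ℤ) * (Fintype.card F : ℂ) ^ (2 * k + 1)) ≠ 0 :=
      mul_ne_zero hχ0 (pow_ne_zero _ hq0)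
    refine mul_left_cancel₀ h4 (h3.trans ?_)
    ring
  have h3 : monicCharSum F θ (2 * k) ^ 2 = ((Fintype.card F : ℤ) ^ k) ^ 2 := by exact_mod_cast h2
  have hq : Odd (Fintype.card F : ℤ) := by
    exact_mod_cast Nat.odd_iff.2 (FiniteField.odd_card_of_char_ne_two hF)
  refine (sq_eq_sq_iff_eq_or_eq_neg.1 h3).resolve_right fun h4 => ?_
  have h5 := four_dvd_monicCharSum_sub hF hθ
  rw [quadraticChar_derivative_minpoly_of_odd hF hθ hk, hk, Nat.add_sub_cancel, h4] at h5
  have h6 := four_dvd_pow_mul_sub hq k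
  have h7 : (4 : ℤ) ∣ (Fintype.card F : ℤ) ^ k - quadraticChar K (-1) ^ k := by
    refine dvd_trans ?_ (sub_dvd_pow_sub_pow _ _ k)
    have h8 : quadraticChar K (-1) = quadraticChar F (-1) := by
      have := quadraticChar_algebraMap (K := K) hF (-1)
      rwa [map_neg, map_one, ← map_pow, quadraticChar_pow_of_odd _ hn_odd] at this
    rw [h8, quadraticChar_neg_one hF, ZMod.χ₄_nat_eq_if_mod_four]
    have := FiniteField.odd_card_of_char_ne_two hF
    split_ifs <;> omega
  obtain ⟨r, hr⟩ := hq.pow (n := k)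
  omega

theorem monicCharSum_finrank_sub_one_of_even (hF : ringChar F ≠ 2) {θ : K}
    (hθ : (minpoly F θ).natDegree = Module.finrank F K) {k : ℕ}
    (hk : Module.finrank F K = 2 * (k + 1)) :
    monicCharSum F θ (2 * k + 1) = -(Fintype.card F : ℤ) ^ k := by
  have hK : ringChar K ≠ 2 := by rwa [← Algebra.ringChar_eq F K]
  obtain ⟨G, g, hG, hg, -, hrel⟩ := exists_gaussSum_relations hF hθ
  have hn_even : Even (Module.finrank F K) := hk ▸ even_two_mul _
  have hq0 : (Fintype.card F : ℂ) ≠ 0 := by simp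
  have hχ : quadraticChar K (-1) = 1 := by
    have := quadraticChar_algebraMap (K := K) hF (-1)
    rw [map_neg, map_one, hk, pow_mul, quadraticChar_sq_one (by simp), one_pow] at this
    exact this
  have h1 := hrel (2 * k + 1) 0 (by omega)
  rw [polyCharSum_eq_ite hF, if_pos hn_even, monicCharSum_zero, hg hn_even] at h1
  have h2 : (monicCharSum F θ (2 * k + 1) : ℂ) ^ 2 = ((Fintype.card F : ℂ) ^ k) ^ 2 := by
    have h3 := congrArg (· ^ 2) h1
    simp only [mul_pow, hG, hχ, Finset.range_zero, Finset.sum_empty, mul_zero,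
      Int.cast_zero, zero_add, Int.cast_one, mul_one, hk, one_mul] at h3
    refine mul_left_cancel₀ (pow_ne_zero (2 * (k + 1)) hq0) (h3.trans ?_)
    ring
  have h3 : monicCharSum F θ (2 * k + 1) ^ 2 = ((Fintype.card F : ℤ) ^ k) ^ 2 := by
    exact_mod_cast h2
  have hq : Odd (Fintype.card F : ℤ) := by
    exact_mod_cast Nat.odd_iff.2 (FiniteField.odd_card_of_char_ne_two hF)
  refine (sq_eq_sq_iff_eq_or_eq_neg.1 h3).resolve_left fun h4 => ?_
  have h5 := four_dvd_monicCharSum_sub hF hθ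
  rw [quadraticChar_derivative_minpoly_of_even hF hθ hk, hk,
    (by omega : 2 * (k + 1) - 1 = 2 * k + 1), h4] at h5
  have h6 := four_dvd_pow_mul_sub hq k
  obtain ⟨r, hr⟩ := hq.pow (n := k)
  obtain ⟨u, hu⟩ := hq
  have hr' : Fintype.card F ^ (k + 1) % 2 = 1 := by
    rw [Nat.pow_mod, FiniteField.odd_card_of_char_ne_two hF, one_pow, Nat.one_mod]
  have h7 : (4 : ℤ) ∣ (-1) ^ ((Fintype.card F ^ (k + 1) + 1) / 2) +
      (Fintype.card F : ℤ) ^ (k + 1) := by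
    have h8 : (Fintype.card F : ℤ) ^ (k + 1) = ((Fintype.card F ^ (k + 1) : ℕ) : ℤ) := by
      push_cast
      rfl
    rw [h8]
    rcases Nat.even_or_odd ((Fintype.card F ^ (k + 1) + 1) / 2) with h | h
    · rw [h.neg_one_pow]
      obtain ⟨v, hv⟩ := h
      omega
    · rw [h.neg_one_pow]
      obtain ⟨v, hv⟩ := h
      omega
  have h8 : (4 : ℤ) ∣ ((Fintype.card F : ℤ) - 1) * ((Fintype.card F : ℤ) ^ k - 1) := by
    rw [hr, hu]
    exact ⟨u * r, by ring⟩
  have h9 : (4 : ℤ) ∣ (Fintype.card F : ℤ) ^ (2 * k + 1) - (Fintype.card F : ℤ) := by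
    rw [pow_succ, ← sub_one_mul]
    exact h6.mul_right _
  have h10 : ((Fintype.card F : ℤ) - 1) * ((Fintype.card F : ℤ) ^ k - 1) =
    (Fintype.card F : ℤ) ^ (k + 1) - Fintype.card F - (Fintype.card F : ℤ) ^ k + 1 := by ring
  omega

theorem pow_mul_monicCharSum_of_odd (hF : ringChar F ≠ 2) {θ : K}
    (hθ : (minpoly F θ).natDegree = Module.finrank F K) {k j m : ℕ}
    (hk : Module.finrank F K = 2 * k + 1) (hjm : j + m = 2 * k) :
    (Fintype.card F : ℤ) ^ k * monicCharSum F θ j =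
      (Fintype.card F : ℤ) ^ j * monicCharSum F θ m := by
  obtain ⟨G, g, -, -, hg, hrel⟩ := exists_gaussSum_relations hF hθ
  have hn_odd : Odd (Module.finrank F K) := ⟨k, hk⟩
  have hq0 : (Fintype.card F : ℂ) ≠ 0 := by simp
  have hg0 : g ≠ 0 := by
    intro h
    have := hg hn_odd
    rw [h, sq, zero_mul] at this
    exact mul_ne_zero (Int.cast_ne_zero.2 quadraticChar_neg_one_ne_zero) hq0 this.symm
  have h1 := hrel (2 * k) 0 (by omega)
  have h2 := hrel j m (by omega)
  rw [polyCharSum_eq_ite hF, if_neg (Nat.not_even_iff_odd.2 hn_odd)] at h1 h2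
  rw [monicCharSum_zero, monicCharSum_finrank_sub_one_of_odd hF hθ hk] at h1
  push_cast at h1 h2
  have h3 : G = (Fintype.card F : ℂ) ^ k * g := by
    refine mul_right_cancel₀ (pow_ne_zero k hq0) (h1.trans ?_)
    ring
  have h4 : (Fintype.card F : ℂ) ^ k * monicCharSum F θ j =
      (Fintype.card F : ℂ) ^ j * monicCharSum F θ m := by
    refine mul_left_cancel₀ hg0 ?_
    rw [h3] at h2
    linear_combination h2
  exact_mod_cast h4

theorem pow_mul_monicCharSum_of_even (hF : ringChar F ≠ 2) {θ : K}
    (hθ : (minpoly F θ).natDegree = Module.finrank F K) {k j m : ℕ}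
    (hk : Module.finrank F K = 2 * k) (hjm : j + m + 1 = 2 * k) :
    (Fintype.card F : ℤ) ^ k * monicCharSum F θ j = (Fintype.card F : ℤ) ^ j *
      (((Fintype.card F : ℤ) - 1) * ∑ i ∈ Finset.range m, monicCharSum F θ i -
        monicCharSum F θ m) := by
  obtain ⟨G, g, -, hg, -, hrel⟩ := exists_gaussSum_relations hF hθ
  have hn_even : Even (Module.finrank F K) := hk ▸ even_two_mul _
  have hq0 : (Fintype.card F : ℂ) ≠ 0 := by simp
  obtain ⟨r, rfl⟩ : ∃ r, k = r + 1 := ⟨k - 1, by omega⟩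
  have h1 := hrel (2 * r + 1) 0 (by omega)
  have h2 := hrel j m (by omega)
  rw [polyCharSum_eq_ite hF, if_pos hn_even, hg hn_even] at h1 h2
  rw [monicCharSum_zero, monicCharSum_finrank_sub_one_of_even hF hθ hk] at h1
  push_cast at h1 h2
  have h3 : G = (Fintype.card F : ℂ) ^ (r + 1) := by
    refine mul_right_cancel₀ (neg_ne_zero.2 (pow_ne_zero r hq0)) (h1.trans ?_)
    simp only [Finset.range_zero, Finset.sum_empty]
    ring
  have h4 : (Fintype.card F : ℂ) ^ (r + 1) * monicCharSum F θ j = (Fintype.card F : ℂ) ^ j *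
      (((Fintype.card F : ℂ) - 1) * ∑ i ∈ Finset.range m, (monicCharSum F θ i : ℂ) -
        monicCharSum F θ m) := by
    rw [← h3, h2]
    ring
  exact_mod_cast h4

theorem degree_monicOfFin {R : Type*} [Ring R] [Nontrivial R] {k : ℕ} (w : Fin k → R) :
    (monicOfFin k w).degree = k :=
  degree_X_pow_add (degree_polyOfFin_lt w)

theorem natDegree_monicOfFin {R : Type*} [Ring R] [Nontrivial R] {k : ℕ} (w : Fin k → R) :
    (monicOfFin k w).natDegree = k :=
  natDegree_eq_of_degree_eq_some (degree_monicOfFin w)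

theorem monic_monicOfFin {R : Type*} [Ring R] [Nontrivial R] {k : ℕ} (w : Fin k → R) :
    (monicOfFin k w).Monic :=
  monic_X_pow_add (degree_polyOfFin_lt w)

theorem monicOfFin_injective {R : Type*} [Ring R] (k : ℕ) :
    Function.Injective (monicOfFin k : (Fin k → R) → R[X]) := fun _ _ h =>
  polyOfFin_injective k (add_left_cancel h)

theorem range_monicOfFin (R : Type*) [Ring R] [Nontrivial R] (k : ℕ) :
    Set.range (monicOfFin k : (Fin k → R) → R[X]) = {B | B.Monic ∧ B.natDegree = k} := by
  ext B
  constructor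
  · rintro ⟨w, rfl⟩
    exact ⟨monic_monicOfFin w, natDegree_monicOfFin w⟩
  · rintro ⟨hB, rfl⟩
    have hd : (B - X ^ B.natDegree).degree < (B.natDegree : WithBot ℕ) := by
      have h := degree_sub_lt_left (p := B) (q := X ^ B.natDegree)
        (by rw [degree_X_pow, degree_eq_natDegree hB.ne_zero]) hB.ne_zero
        (by rw [hB.leadingCoeff, (monic_X_pow _).leadingCoeff])
      rwa [degree_eq_natDegree hB.ne_zero] at h
    obtain ⟨w, hw⟩ := exists_polyOfFin_eq hd
    exact ⟨w, by rw [monicOfFin, hw]; abel⟩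

variable (F K) in
/-- The elements of `K` generating `K` over `F`. -/
noncomputable def primitiveElements : Finset K :=
  Finset.univ.filter fun θ => (minpoly F θ).natDegree = Module.finrank F K

omit [Fintype F] in
theorem mem_primitiveElements {θ : K} :
    θ ∈ primitiveElements F K ↔ (minpoly F θ).natDegree = Module.finrank F K := by
  simp [primitiveElements]

theorem splits_map_of_natDegree_dvd {P : F[X]} (hP : Irreducible P)
    (hd : P.natDegree ∣ Module.finrank F K) : (P.map (algebraMap F K)).Splits := by
  have h := hP.natDegree_dvd_iff_dvd_X_pow_card_pow_sub_X.1 hd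
  have hs := (FiniteField.isSplittingField_sub K F).splits
  refine Splits.of_dvd hs ?_ (Polynomial.map_dvd _ ?_)
  · exact (Polynomial.map_ne_zero_iff (algebraMap F K).injective).2
      (FiniteField.X_pow_card_sub_X_ne_zero F Fintype.one_lt_card)
  · rwa [Nat.card_eq_fintype_card, ← Module.card_eq_pow_finrank] at h

omit [Fintype F] in
theorem minpoly_eq_iff_mem_rootSet {P : F[X]} (hP : P.Monic) (hi : Irreducible P) (θ : K) :
    minpoly F θ = P ↔ θ ∈ P.rootSet K := by
  rw [mem_rootSet]
  constructor
  · rintro rfl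
    exact ⟨hP.ne_zero, minpoly.aeval F θ⟩
  · rintro ⟨-, h⟩
    exact (minpoly.eq_of_irreducible_of_monic hi h hP).symm

theorem card_filter_minpoly_eq {P : F[X]} (hP : P.Monic) (hi : Irreducible P)
    (hd : P.natDegree = Module.finrank F K) :
    ((primitiveElements F K).filter fun θ => minpoly F θ = P).card = Module.finrank F K := by
  have h : ((primitiveElements F K).filter fun θ => minpoly F θ = P) = (P.rootSet K).toFinset := by
    ext θ
    rw [Finset.mem_filter, mem_primitiveElements, Set.mem_toFinset,
      ← minpoly_eq_iff_mem_rootSet hP hi]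
    exact ⟨fun h => h.2, fun h => ⟨by rw [h, hd], h⟩⟩
  rw [h, Set.toFinset_card, card_rootSet_eq_natDegree (PerfectField.separable_of_irreducible hi)
    (splits_map_of_natDegree_dvd hi hd.dvd), hd]

theorem coe_image_minpoly_primitiveElements :
    (((primitiveElements F K).image (minpoly F) : Finset F[X]) : Set F[X]) =
      {P | P.Monic ∧ Irreducible P ∧ P.natDegree = Module.finrank F K} := by
  ext P
  simp only [Finset.coe_image, Set.mem_image, Finset.mem_coe, Set.mem_ofPred_eq]
  constructor
  · rintro ⟨θ, hθ, rfl⟩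
    have hθi : IsIntegral F θ := IsIntegral.of_finite F θ
    exact ⟨minpoly.monic hθi, minpoly.irreducible hθi, mem_primitiveElements.1 hθ⟩
  · rintro ⟨hP, hi, hd⟩
    have hpos : 0 < ((primitiveElements F K).filter fun θ => minpoly F θ = P).card := by
      rw [card_filter_minpoly_eq hP hi hd]
      exact Module.finrank_pos
    obtain ⟨θ, hθ⟩ := Finset.card_pos.1 hpos
    exact ⟨θ, Finset.mem_filter.1 hθ⟩

theorem sum_primitiveElements_minpoly (f : F[X] → ℤ) :
    ∑ θ ∈ primitiveElements F K, f (minpoly F θ) = (Module.finrank F K : ℤ) *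
      ∑ᶠ P ∈ {P : F[X] | P.Monic ∧ Irreducible P ∧ P.natDegree = Module.finrank F K}, f P := by
  rw [← coe_image_minpoly_primitiveElements, finsum_mem_coe_finset, Finset.mul_sum,
    ← Finset.sum_fiberwise_of_maps_to (t := (primitiveElements F K).image (minpoly F))
      (g := minpoly F) (fun θ hθ => Finset.mem_image_of_mem _ hθ)]
  refine Finset.sum_congr rfl fun P hP => ?_
  have hP' : P ∈ {P : F[X] | P.Monic ∧ Irreducible P ∧ P.natDegree = Module.finrank F K} := by
    rw [← coe_image_minpoly_primitiveElements]
    exact hP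
  rw [Finset.sum_congr rfl (g := fun _ => f P)
    (fun θ hθ => by rw [(Finset.mem_filter.1 hθ).2]), Finset.sum_const,
    card_filter_minpoly_eq hP'.1 hP'.2.1 hP'.2.2, nsmul_eq_mul]

theorem card_primitiveElements :
    ((primitiveElements F K).card : ℤ) =
      Module.finrank F K * primeCount F (Module.finrank F K) := by
  have h := sum_primitiveElements_minpoly (F := F) (K := K) fun _ => 1
  rw [← coe_image_minpoly_primitiveElements, finsum_mem_coe_finset] at h
  rw [primeCount, ← coe_image_minpoly_primitiveElements, Set.ncard_coe_finset]
  simpa using h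

omit [Fintype F] in
theorem legendreSymbol_minpoly {θ : K} (hθ : (minpoly F θ).natDegree = Module.finrank F K)
    (B : F[X]) : legendreSymbol B (minpoly F θ) = quadraticChar K (aeval θ B) := by
  rw [legendreSymbol, quadraticChar_apply, quadraticCharFun]
  have h0 : minpoly F θ ∣ B ↔ aeval θ B = 0 := minpoly.dvd_iff
  have h1 : (∃ C : F[X], minpoly F θ ∣ C ^ 2 - B) ↔ IsSquare (aeval θ B) := by
    constructor
    · rintro ⟨C, hC⟩
      refine ⟨aeval θ C, ?_⟩
      have h := minpoly.dvd_iff.1 hC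
      rw [map_sub, map_pow, sub_eq_zero] at h
      rw [← h, sq]
    · rintro ⟨c, hc⟩
      obtain ⟨C, -, rfl⟩ := exists_aeval_eq hθ c
      exact ⟨C, minpoly.dvd_iff.2 (by rw [map_sub, map_pow, hc]; ring)⟩
  simp only [h0, h1]

theorem finrank_mul_doubleCharSum (β : ℕ) :
    (Module.finrank F K : ℤ) * doubleCharSum F β (Module.finrank F K) =
      ∑ θ ∈ primitiveElements F K, monicCharSum F θ β := by
  rw [doubleCharSum, ← sum_primitiveElements_minpoly]
  refine Finset.sum_congr rfl fun θ hθ => ?_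
  rw [← range_monicOfFin, finsum_mem_range (monicOfFin_injective β), finsum_eq_sum_of_fintype]
  exact Finset.sum_congr rfl fun w _ => legendreSymbol_minpoly (mem_primitiveElements.1 hθ) _

theorem Polynomial.Monic.eq_of_sq_eq_sq {R : Type*} [Field R] (hR : ringChar R ≠ 2) {f g : R[X]}
    (hf : f.Monic) (hg : g.Monic) (h : f ^ 2 = g ^ 2) : f = g := by
  refine (sq_eq_sq_iff_eq_or_eq_neg.1 h).resolve_right fun hn => ?_
  have hl := congrArg Polynomial.leadingCoeff hn
  rw [leadingCoeff_neg, hf.leadingCoeff, hg.leadingCoeff] at hl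
  exact Ring.neg_one_ne_one_of_char_ne_two hR hl.symm

omit [Fintype F] in
theorem exists_monic_sq_eq_of_map_eq (hF : ringChar F ≠ 2) {M : F[X]} (hM : M.Monic) {c : K}
    {g : K[X]} (h : M.map (algebraMap F K) = C c * g ^ 2) : ∃ f : F[X], f.Monic ∧ M = f ^ 2 := by
  have hK : ringChar K ≠ 2 := by rwa [← Algebra.ringChar_eq F K]
  have hg0 : g ≠ 0 := by
    rintro rfl
    exact (hM.map (algebraMap F K)).ne_zero (by rw [h]; simp)
  have hl0 : g.leadingCoeff ≠ 0 := leadingCoeff_ne_zero.2 hg0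
  have hc : c * g.leadingCoeff ^ 2 = 1 := by
    have h1 := (hM.map (algebraMap F K)).leadingCoeff
    rwa [h, leadingCoeff_mul, leadingCoeff_C, leadingCoeff_pow] at h1
  have hm : (g * C g.leadingCoeff⁻¹).Monic := monic_mul_leadingCoeff_inv hg0
  have hsq : M.map (algebraMap F K) = (g * C g.leadingCoeff⁻¹) ^ 2 := by
    have hc' : c = g.leadingCoeff⁻¹ ^ 2 := by
      field_simp
      exact hc
    rw [h, mul_pow, ← C_pow, ← hc', mul_comm]
  generalize g * C g.leadingCoeff⁻¹ = f at hm hsq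
  have hfix : ∀ σ : Gal(K/F), f.map (σ : K →+* K) = f := by
    intro σ
    refine Monic.eq_of_sq_eq_sq hK (hm.map _) hm ?_
    rw [← Polynomial.map_pow, ← hsq, Polynomial.map_map]
    congr 1
    ext x
    simp
  have hlift : f ∈ lifts (algebraMap F K) := by
    rw [lifts_iff_coeff_lifts]
    intro i
    rw [IsGalois.mem_range_algebraMap_iff_fixed]
    intro σ
    conv_rhs => rw [← hfix σ]
    rw [coeff_map]
    rfl
  obtain ⟨f₀, rfl⟩ := (mem_lifts _).1 hlift
  refine ⟨f₀, (monic_map_iff (f := algebraMap F K)).1 hm, ?_⟩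
  exact map_injective _ (algebraMap F K).injective (by rw [hsq, Polynomial.map_pow])

theorem card_compl_primitiveElements_le :
    (primitiveElements F K)ᶜ.card ≤
      Module.finrank F K * Fintype.card F ^ (Module.finrank F K / 2) := by
  set n := Module.finrank F K with hn
  have hn0 : 0 < n := Module.finrank_pos
  have hq1 : 1 < Fintype.card F := Fintype.one_lt_card
  have hsub : (primitiveElements F K)ᶜ ⊆ (Finset.Icc 1 (n / 2)).biUnion fun d =>
      ((X ^ Fintype.card F ^ d - X : F[X]).rootSet K).toFinset := by
    intro θ hθ
    rw [Finset.mem_compl, mem_primitiveElements] at hθ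
    have hθi : IsIntegral F θ := IsIntegral.of_finite F θ
    obtain ⟨e, he⟩ := minpoly.degree_dvd (K := F) hθi
    have hd0 : 0 < (minpoly F θ).natDegree := minpoly.natDegree_pos hθi
    have he2 : 2 ≤ e := by
      rcases e with _ | _ | e
      · simp at he; omega
      · simp at he; exact absurd he.symm hθ
      · omega
    rw [Finset.mem_biUnion]
    refine ⟨(minpoly F θ).natDegree, Finset.mem_Icc.2 ⟨hd0, ?_⟩, ?_⟩
    · rw [Nat.le_div_iff_mul_le two_pos, hn, he]
      exact Nat.mul_le_mul_left _ he2
    · rw [Set.mem_toFinset, mem_rootSet]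
      refine ⟨FiniteField.X_pow_card_pow_sub_X_ne_zero F hd0.ne' hq1, ?_⟩
      have h := (minpoly.irreducible hθi).natDegree_dvd_iff_dvd_X_pow_card_pow_sub_X.1 dvd_rfl
      rw [Nat.card_eq_fintype_card] at h
      exact minpoly.dvd_iff.1 h
  refine (Finset.card_le_card hsub).trans
    ((Finset.card_biUnion_le_card_mul _ _ (Fintype.card F ^ (n / 2)) ?_).trans ?_)
  · intro d hd
    obtain ⟨hd1, hd2⟩ := Finset.mem_Icc.1 hd
    rw [Set.toFinset_card, ← Nat.card_eq_fintype_card, Nat.card_coe_set_eq]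
    refine (ncard_rootSet_le _ _).trans ?_
    rw [FiniteField.X_pow_card_pow_sub_X_natDegree_eq F (by omega) hq1]
    exact Nat.pow_le_pow_right (by omega) hd2
  · rw [Nat.card_Icc]
    exact Nat.mul_le_mul_right _ (by omega)

theorem abs_sum_primitiveElements_quadraticChar_le (hF : ringChar F ≠ 2) {M : F[X]}
    (hM : M.Monic) (hsq : ∀ f : F[X], M ≠ f ^ 2) :
    |∑ θ ∈ primitiveElements F K, quadraticChar K (aeval θ M)| ≤
      7 * M.natDegree *
          (Fintype.card F : ℤ) ^ (Module.finrank F K - Module.finrank F K / 2) +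
        Module.finrank F K * (Fintype.card F : ℤ) ^ (Module.finrank F K / 2) := by
  obtain ⟨p, hp⟩ := CharP.exists F
  have := hp
  obtain ⟨s, hprime, hs⟩ := FiniteField.card F p
  have : Fact p.Prime := ⟨hprime⟩
  have : CharP K p := charP_of_injective_algebraMap (algebraMap F K).injective p
  set n := Module.finrank F K with hn
  have hp2 : p ≠ 2 := by rwa [ringChar.eq F p] at *
  have hcard : Fintype.card K = p ^ ((s : ℕ) * (n / 2)) * p ^ ((s : ℕ) * (n - n / 2)) := by
    rw [← pow_add, ← mul_add, Module.card_eq_pow_finrank (K := F), hs, ← pow_mul]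
    congr 2
    omega
  have h := abs_sum_quadraticChar_eval_le (K := K) hp2 hcard
    (Nat.mul_le_mul_left _ (by omega)) (f := M.map (algebraMap F K)) (fun c g h => by
      obtain ⟨f, -, hf⟩ := exists_monic_sq_eq_of_map_eq hF hM h
      exact hsq f hf)
  simp only [eval_map_algebraMap, natDegree_map] at h
  rw [pow_mul, ← Nat.cast_pow, ← hs] at h
  have hc : |∑ θ ∈ (primitiveElements F K)ᶜ, quadraticChar K (aeval θ M)| ≤
      (n : ℤ) * (Fintype.card F : ℤ) ^ (n / 2) := by
    refine (Finset.abs_sum_le_sum_abs _ _).trans ((Finset.sum_le_card_nsmul _ _ 1 ?_).trans ?_)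
    · intro θ _
      by_cases h0 : aeval θ M = 0
      · simp [h0]
      · rcases quadraticChar_dichotomy h0 with h | h <;> simp [h]
    · rw [nsmul_eq_mul, mul_one]
      exact_mod_cast card_compl_primitiveElements_le (F := F) (K := K)
  rw [← Finset.sum_add_sum_compl (primitiveElements F K)] at h
  rw [abs_le] at *
  constructor <;> linarith [h.1, h.2, hc.1, hc.2]

theorem card_filter_isSquare_monicOfFin (hF : ringChar F ≠ 2) (β : ℕ) :
    (Finset.univ.filter fun w : Fin β → F => ∃ f : F[X], monicOfFin β w = f ^ 2).card =
      if Even β then Fintype.card F ^ (β / 2) else 0 := by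
  split_ifs with hβ
  · obtain ⟨m, rfl⟩ := hβ
    rw [← Finset.card_image_of_injective _ (monicOfFin_injective (R := F) (m + m))]
    have himg : (Finset.univ.filter fun w : Fin (m + m) → F =>
        ∃ f : F[X], monicOfFin (m + m) w = f ^ 2).image (monicOfFin (m + m)) =
        Finset.univ.image fun v : Fin m → F => monicOfFin m v ^ 2 := by
      ext B
      simp only [Finset.mem_image, Finset.mem_filter, Finset.mem_univ, true_and]
      constructor
      · rintro ⟨w, ⟨f, hf⟩, rfl⟩
        obtain ⟨g, hg, hfg⟩ := exists_monic_sq_eq_of_map_eq (K := F) hF (monic_monicOfFin w)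
          (c := 1) (g := f) (by simp [hf])
        have hdeg := congrArg natDegree hfg
        rw [natDegree_monicOfFin, natDegree_pow] at hdeg
        obtain ⟨v, rfl⟩ : g ∈ Set.range (monicOfFin m) := by
          rw [range_monicOfFin]
          exact ⟨hg, by omega⟩
        exact ⟨v, hfg.symm⟩
      · rintro ⟨v, rfl⟩
        obtain ⟨w, hw⟩ : monicOfFin m v ^ 2 ∈ Set.range (monicOfFin (m + m)) := by
          rw [range_monicOfFin]
          exact ⟨(monic_monicOfFin v).pow 2, by rw [natDegree_pow, natDegree_monicOfFin]; omega⟩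
        exact ⟨w, ⟨_, hw⟩, hw⟩
    rw [himg, Finset.card_image_of_injective _ fun v v' h => monicOfFin_injective m
      (Monic.eq_of_sq_eq_sq hF (monic_monicOfFin v) (monic_monicOfFin v') h), Finset.card_univ,
      Fintype.card_fun, Fintype.card_fin]
    congr 1
    omega
  · rw [Finset.card_eq_zero, Finset.filter_eq_empty_iff]
    rintro w - ⟨f, hf⟩
    have hdeg := congrArg natDegree hf
    rw [natDegree_monicOfFin, natDegree_pow] at hdeg
    exact hβ ⟨f.natDegree, by omega⟩

omit [Fintype F] in
theorem sum_primitiveElements_quadraticChar_sq {f : F[X]} (hf : f ≠ 0)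
    (hd : f.natDegree < Module.finrank F K) :
    ∑ θ ∈ primitiveElements F K, quadraticChar K (aeval θ (f ^ 2)) =
      (primitiveElements F K).card := by
  rw [Finset.sum_congr rfl (g := fun _ => (1 : ℤ))]
  · simp
  · intro θ hθ
    rw [map_pow]
    refine quadraticChar_sq_one' fun h0 => hf ?_
    exact eq_zero_of_aeval_eq_zero (mem_primitiveElements.1 hθ)
      ((natDegree_lt_iff_degree_lt hf).1 hd) h0

theorem abs_doubleCharSum_sub_le_of_finrank (hF : ringChar F ≠ 2) {β : ℕ}
    (hβ : β < Module.finrank F K) :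
    |doubleCharSum F β (Module.finrank F K) - (primeCount F (Module.finrank F K) : ℤ) *
        (if Even β then (Fintype.card F : ℤ) ^ (β / 2) else 0)| ≤
      8 * (Fintype.card F : ℤ) ^ (Module.finrank F K - Module.finrank F K / 2 + β) := by
  have hq1 : (1 : ℤ) ≤ Fintype.card F := by exact_mod_cast Fintype.card_pos
  have hn0 : 0 < Module.finrank F K := Module.finrank_pos
  have hsum := finrank_mul_doubleCharSum (F := F) (K := K) β
  have hprim := card_primitiveElements (F := F) (K := K)
  have hcount := card_filter_isSquare_monicOfFin hF β
  have hbound := fun w : Fin β → F => abs_sum_primitiveElements_quadraticChar_le (K := K) hF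
    (monic_monicOfFin w)
  simp only [natDegree_monicOfFin] at hbound
  have hsq := fun (f : F[X]) (w : Fin β → F) (hw : monicOfFin β w = f ^ 2) =>
    sum_primitiveElements_quadraticChar_sq (K := K) (f := f)
      (by rintro rfl; exact (monic_monicOfFin w).ne_zero (by rw [hw]; simp))
      (by have := congrArg natDegree hw
          rw [natDegree_monicOfFin, natDegree_pow] at this; omega)
  set n := Module.finrank F K with hn
  set q : ℤ := (Fintype.card F : ℤ) with hq
  set T := Finset.univ.filter fun w : Fin β → F => ∃ f : F[X], monicOfFin β w = f ^ 2 with hT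
  have hsplit : (n : ℤ) * doubleCharSum F β n - T.card * (primitiveElements F K).card =
      ∑ w ∈ Tᶜ, ∑ θ ∈ primitiveElements F K, quadraticChar K (aeval θ (monicOfFin β w)) := by
    rw [hsum]
    simp only [monicCharSum]
    rw [Finset.sum_comm, ← Finset.sum_add_sum_compl T, sub_eq_iff_eq_add, add_comm,
      add_right_inj]
    rw [Finset.sum_congr rfl (g := fun _ => ((primitiveElements F K).card : ℤ))]
    · simp
    · intro w hw
      obtain ⟨f, hf⟩ := (Finset.mem_filter.1 hw).2
      rw [hf]
      exact hsq f w hf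
  have hle : q ^ (n / 2) ≤ q ^ (n - n / 2) := pow_le_pow_right₀ hq1 (by omega)
  have hcompl : |(n : ℤ) * doubleCharSum F β n - T.card * (primitiveElements F K).card| ≤
      q ^ β * (8 * n * q ^ (n - n / 2)) := by
    rw [hsplit]
    refine (Finset.abs_sum_le_sum_abs _ _).trans
      ((Finset.sum_le_card_nsmul _ _ (8 * n * q ^ (n - n / 2)) ?_).trans ?_)
    · intro w hw
      have hw' : ∀ f : F[X], monicOfFin β w ≠ f ^ 2 := by
        intro f hf
        exact (Finset.mem_compl.1 hw) (Finset.mem_filter.2 ⟨Finset.mem_univ _, f, hf⟩)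
      refine (hbound w hw').trans ?_
      have hβn : (β : ℤ) ≤ n := by exact_mod_cast hβ.le
      have h1 : (β : ℤ) * q ^ (n - n / 2) ≤ n * q ^ (n - n / 2) := by gcongr
      have h2 : (n : ℤ) * q ^ (n / 2) ≤ n * q ^ (n - n / 2) := by gcongr
      linarith
    · rw [nsmul_eq_mul]
      gcongr
      calc ((Tᶜ.card : ℕ) : ℤ) ≤ (Fintype.card (Fin β → F) : ℤ) := by
            exact_mod_cast Finset.card_le_univ _
        _ = q ^ β := by rw [Fintype.card_fun, Fintype.card_fin, Nat.cast_pow]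
  have hcount' : (T.card : ℤ) = if Even β then q ^ (β / 2) else 0 := by
    rw [hcount]
    split_ifs <;> simp [hq]
  rw [hprim, hcount'] at hcompl
  have hnz : (0 : ℤ) < n := by exact_mod_cast hn0
  refine le_of_mul_le_mul_left ?_ hnz
  calc (n : ℤ) * |doubleCharSum F β n - (primeCount F n : ℤ) *
        (if Even β then q ^ (β / 2) else 0)|
      = |(n : ℤ) * doubleCharSum F β n - (if Even β then q ^ (β / 2) else 0) *
          (n * primeCount F n)| := by
        rw [← abs_of_pos hnz, ← abs_mul, abs_of_pos hnz]
        congr 1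
        ring
    _ ≤ q ^ β * (8 * n * q ^ (n - n / 2)) := hcompl
    _ = n * (8 * q ^ (n - n / 2 + β)) := by ring

theorem pow_mul_doubleCharSum_of_odd_of_finrank (hF : ringChar F ≠ 2) {k j m : ℕ}
    (hk : Module.finrank F K = 2 * k + 1) (hjm : j + m = 2 * k) :
    (Fintype.card F : ℤ) ^ k * doubleCharSum F j (2 * k + 1) =
      (Fintype.card F : ℤ) ^ j * doubleCharSum F m (2 * k + 1) := by
  have hn : (Module.finrank F K : ℤ) ≠ 0 := by exact_mod_cast (Module.finrank_pos).ne'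
  refine mul_left_cancel₀ hn ?_
  rw [← hk, mul_left_comm, finrank_mul_doubleCharSum, mul_left_comm (Module.finrank F K : ℤ),
    finrank_mul_doubleCharSum, Finset.mul_sum, Finset.mul_sum]
  exact Finset.sum_congr rfl fun θ hθ =>
    pow_mul_monicCharSum_of_odd hF (mem_primitiveElements.1 hθ) hk hjm

theorem pow_mul_doubleCharSum_of_even_of_finrank (hF : ringChar F ≠ 2) {k j m : ℕ}
    (hk : Module.finrank F K = 2 * k) (hjm : j + m + 1 = 2 * k) :
    (Fintype.card F : ℤ) ^ k * doubleCharSum F j (2 * k) = (Fintype.card F : ℤ) ^ j *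
      (((Fintype.card F : ℤ) - 1) * ∑ i ∈ Finset.range m, doubleCharSum F i (2 * k) -
        doubleCharSum F m (2 * k)) := by
  have hn : (Module.finrank F K : ℤ) ≠ 0 := by exact_mod_cast (Module.finrank_pos).ne'
  refine mul_left_cancel₀ hn ?_
  rw [← hk, mul_left_comm, finrank_mul_doubleCharSum, mul_left_comm (Module.finrank F K : ℤ),
    mul_sub, mul_left_comm (Module.finrank F K : ℤ), Finset.mul_sum (Finset.range m)]
  simp only [finrank_mul_doubleCharSum]
  rw [Finset.sum_comm, Finset.mul_sum, Finset.mul_sum, ← Finset.sum_sub_distrib, Finset.mul_sum]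
  exact Finset.sum_congr rfl fun θ hθ =>
    pow_mul_monicCharSum_of_even hF (mem_primitiveElements.1 hθ) hk hjm

end PrimitiveElement

section DoubleCharSum

variable {F : Type*} [Field F] [Fintype F]

variable (F) in
theorem exists_extension_finrank_eq {n : ℕ} (hn : 0 < n) :
    ∃ (K : Type) (_ : Field K) (_ : Fintype K) (_ : Algebra F K), Module.finrank F K = n := by
  obtain ⟨p, hp⟩ := CharP.exists F
  have := hp
  obtain ⟨s, hprime, -⟩ := FiniteField.card F p
  have : Fact p.Prime := ⟨hprime⟩
  have : NeZero n := ⟨hn.ne'⟩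
  exact ⟨FiniteField.Extension F p n, inferInstance, Fintype.ofFinite _, inferInstance,
    FiniteField.finrank_extension F p n⟩

/-- The duality `S(j; n) = q^{j − (n−1)/2} S(n−1−j; n)` for odd `n`. -/
theorem pow_mul_doubleCharSum_of_odd (hF : ringChar F ≠ 2) {k j m : ℕ} (hjm : j + m = 2 * k) :
    (Fintype.card F : ℤ) ^ k * doubleCharSum F j (2 * k + 1) =
      (Fintype.card F : ℤ) ^ j * doubleCharSum F m (2 * k + 1) := by
  obtain ⟨K, _, _, _, hk⟩ := exists_extension_finrank_eq F (Nat.succ_pos (2 * k))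
  exact pow_mul_doubleCharSum_of_odd_of_finrank hF hk hjm

/-- The duality relating `S(j; n)` to the sums `S(i; n)`, `i ≤ n − 1 − j`, for even `n`. -/
theorem pow_mul_doubleCharSum_of_even (hF : ringChar F ≠ 2) {k j m : ℕ}
    (hjm : j + m + 1 = 2 * k) :
    (Fintype.card F : ℤ) ^ k * doubleCharSum F j (2 * k) = (Fintype.card F : ℤ) ^ j *
      (((Fintype.card F : ℤ) - 1) * ∑ i ∈ Finset.range m, doubleCharSum F i (2 * k) -
        doubleCharSum F m (2 * k)) := by
  obtain ⟨K, _, _, _, hk⟩ := exists_extension_finrank_eq F (n := 2 * k) (by omega)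
  exact pow_mul_doubleCharSum_of_even_of_finrank hF hk hjm

/-- The Weil bound for `S(β; n)`, with main term coming from the squares. -/
theorem abs_doubleCharSum_sub_le (hF : ringChar F ≠ 2) {β n : ℕ} (hβ : β < n) :
    |doubleCharSum F β n - (primeCount F n : ℤ) *
        (if Even β then (Fintype.card F : ℤ) ^ (β / 2) else 0)| ≤
      8 * (Fintype.card F : ℤ) ^ (n - n / 2 + β) := by
  obtain ⟨K, _, _, _, rfl⟩ := exists_extension_finrank_eq F (n := n) (by omega)
  exact abs_doubleCharSum_sub_le_of_finrank hF hβ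

theorem abs_doubleCharSum_le_of_odd (hF : ringChar F ≠ 2) {β k : ℕ} (hβ : Odd β)
    (hlt : β < 2 * k + 1) :
    |doubleCharSum F β (2 * k + 1)| ≤ 8 * (Fintype.card F : ℤ) ^ (2 * k + 1) := by
  have hq : (0 : ℤ) < Fintype.card F := by exact_mod_cast Fintype.card_pos
  obtain ⟨m, hm⟩ : ∃ m, β + m = 2 * k := ⟨2 * k - β, by omega⟩
  have hd := pow_mul_doubleCharSum_of_odd hF hm
  have hmo : ¬ Even m := by
    obtain ⟨b, rfl⟩ := hβ
    rintro ⟨c, rfl⟩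
    omega
  have hb := abs_doubleCharSum_sub_le hF (β := m) (n := 2 * k + 1) (by omega)
  rw [if_neg hmo, mul_zero, sub_zero] at hb
  set q : ℤ := (Fintype.card F : ℤ)
  refine le_of_mul_le_mul_left ?_ (pow_pos hq k)
  calc q ^ k * |doubleCharSum F β (2 * k + 1)|
      = q ^ β * |doubleCharSum F m (2 * k + 1)| := by
        rw [← abs_of_pos (pow_pos hq k), ← abs_mul, hd, abs_mul, abs_of_pos (pow_pos hq β)]
    _ ≤ q ^ β * (8 * q ^ (2 * k + 1 - (2 * k + 1) / 2 + m)) := by gcongr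
    _ = q ^ k * (8 * q ^ (2 * k + 1)) := by
        rw [mul_left_comm, mul_left_comm (q ^ k), ← pow_add, ← pow_add]
        congr 2
        omega

theorem sub_one_mul_sum_range_ite_even (q : ℤ) (c : ℕ) :
    (q - 1) * ∑ i ∈ Finset.range (2 * c), (if Even i then q ^ (i / 2) else 0) = q ^ c - 1 := by
  induction c with
  | zero => simp
  | succ c ih =>
    have h1 : ¬ Even (2 * c + 1) := by simp
    rw [show 2 * (c + 1) = 2 * c + 1 + 1 by ring, Finset.sum_range_succ, Finset.sum_range_succ,
      if_neg h1, if_pos (even_two_mul c), mul_add, mul_add, ih, Nat.mul_div_cancel_left _ two_pos]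
    ring

theorem abs_doubleCharSum_add_le_of_even (hF : ringChar F ≠ 2) {β k : ℕ} (hβ : Odd β)
    (hlt : β < 2 * k) :
    |(Fintype.card F : ℤ) ^ k * doubleCharSum F β (2 * k) +
        (Fintype.card F : ℤ) ^ β * primeCount F (2 * k)| ≤
      (Fintype.card F : ℤ) ^ k * (16 * (Fintype.card F : ℤ) ^ (2 * k)) := by
  have hq : (1 : ℤ) ≤ Fintype.card F := by exact_mod_cast Fintype.card_pos
  obtain ⟨c, hc⟩ : ∃ c, β + 2 * c + 1 = 2 * k := by
    obtain ⟨b, rfl⟩ := hβ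
    exact ⟨k - b - 1, by omega⟩
  have hd := pow_mul_doubleCharSum_of_even hF hc
  have hb := fun (i : ℕ) (hi : i < 2 * k) => abs_doubleCharSum_sub_le hF hi
  simp only [show 2 * k - 2 * k / 2 = k by omega] at hb
  have hgeom := sub_one_mul_sum_range_ite_even (Fintype.card F : ℤ) c
  have hm := hb (2 * c) (by omega)
  rw [if_pos (even_two_mul c), Nat.mul_div_cancel_left _ two_pos] at hm
  set q : ℤ := (Fintype.card F : ℤ)
  set P : ℤ := (primeCount F (2 * k) : ℤ)
  set S : ℕ → ℤ := fun i => doubleCharSum F i (2 * k)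
  set u : ℕ → ℤ := fun i => if Even i then q ^ (i / 2) else 0
  have hsum : |∑ i ∈ Finset.range (2 * c), (S i - P * u i)| ≤
      ∑ i ∈ Finset.range (2 * c), 8 * q ^ (k + i) := by
    refine (Finset.abs_sum_le_sum_abs _ _).trans (Finset.sum_le_sum fun i hi => hb i ?_)
    have := Finset.mem_range.1 hi
    omega
  have hgs : (q - 1) * ∑ i ∈ Finset.range (2 * c), 8 * q ^ (k + i) =
      8 * q ^ k * (q ^ (2 * c) - 1) := by
    rw [← mul_geom_sum q, Finset.mul_sum, Finset.mul_sum, Finset.mul_sum]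
    exact Finset.sum_congr rfl fun i _ => by ring
  have hkey : q ^ k * S β + q ^ β * P = q ^ β *
      ((q - 1) * ∑ i ∈ Finset.range (2 * c), (S i - P * u i) - (S (2 * c) - P * q ^ c)) := by
    rw [Finset.sum_sub_distrib, ← Finset.mul_sum, hd]
    linear_combination (q ^ β * P) * hgeom
  have herr : |(q - 1) * ∑ i ∈ Finset.range (2 * c), (S i - P * u i) - (S (2 * c) - P * q ^ c)| ≤
      16 * q ^ (k + 2 * c) := by
    refine (abs_sub _ _).trans ?_
    rw [abs_mul, abs_of_nonneg (sub_nonneg.2 hq)]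
    have h1 := mul_le_mul_of_nonneg_left hsum (sub_nonneg.2 hq)
    rw [hgs] at h1
    have h2 : 0 ≤ q ^ k := by positivity
    have h3 : q ^ (k + 2 * c) = q ^ k * q ^ (2 * c) := pow_add _ _ _
    rw [h3] at hm ⊢
    linarith
  change |q ^ k * S β + q ^ β * P| ≤ _
  rw [hkey, abs_mul, abs_of_nonneg (by positivity : 0 ≤ q ^ β)]
  calc q ^ β * |(q - 1) * ∑ i ∈ Finset.range (2 * c), (S i - P * u i) -
        (S (2 * c) - P * q ^ c)| ≤ q ^ β * (16 * q ^ (k + 2 * c)) := by gcongr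
    _ = 16 * q ^ (k + (β + 2 * c)) := by ring
    _ ≤ 16 * q ^ (k + 2 * k) := by
        gcongr
        omega
    _ = q ^ k * (16 * q ^ (2 * k)) := by ring

end DoubleCharSum

/-- For `q` odd, `β` odd and `β < n`,
`S(β; n) = −η_n π_q(n) q^{β − n/2} + O(q^n)`, where `η_n = 1` for `n` even and
`0` for `n` odd.  (Here `q^{β − n/2} = (√q)^{2β − n}`.) -/
theorem doubleCharSum_bootstrap (F : Type*) [Field F] [Fintype F]
    (hq : Odd (Fintype.card F)) :
    ∃ C : ℝ, ∀ n β : ℕ, Odd β → β < n →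
      |((doubleCharSum F β n : ℤ) : ℝ) -
          (-((if Even n then 1 else 0) * (primeCount F n : ℝ) *
            Real.sqrt (Fintype.card F) ^ ((2 * β : ℤ) - n)))| ≤
        C * (Fintype.card F : ℝ) ^ n := by
  have hF : ringChar F ≠ 2 := fun h => by
    have := FiniteField.even_card_iff_char_two.1 h
    rw [Nat.odd_iff] at hq
    omega
  have hq0 : (0 : ℝ) < Fintype.card F := by exact_mod_cast Fintype.card_pos
  refine ⟨16, fun n β hβ hlt => ?_⟩
  rcases Nat.even_or_odd' n with ⟨k, rfl | rfl⟩
  · have h : |((Fintype.card F : ℝ)) ^ k * doubleCharSum F β (2 * k) +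
        (Fintype.card F : ℝ) ^ β * primeCount F (2 * k)| ≤
        (Fintype.card F : ℝ) ^ k * (16 * (Fintype.card F : ℝ) ^ (2 * k)) := by
      exact_mod_cast abs_doubleCharSum_add_le_of_even hF hβ hlt
    have hs : Real.sqrt (Fintype.card F) ^ ((2 * β : ℤ) - ((2 * k : ℕ) : ℤ)) =
        (Fintype.card F : ℝ) ^ β / (Fintype.card F : ℝ) ^ k := by
      rw [show (2 * β : ℤ) - ((2 * k : ℕ) : ℤ) = 2 * ((β : ℤ) - k) by push_cast; ring, zpow_mul,
        zpow_ofNat, Real.sq_sqrt hq0.le, zpow_sub₀ hq0.ne', zpow_natCast, zpow_natCast]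
    rw [if_pos (even_two_mul k), one_mul, hs, sub_neg_eq_add]
    refine le_of_mul_le_mul_left ?_ (pow_pos hq0 k)
    refine le_trans (le_of_eq ?_) h
    rw [← abs_of_pos (pow_pos hq0 k), ← abs_mul, abs_of_pos (pow_pos hq0 k)]
    congr 1
    field_simp
  · have h : |(doubleCharSum F β (2 * k + 1) : ℝ)| ≤ 8 * (Fintype.card F : ℝ) ^ (2 * k + 1) := by
      exact_mod_cast abs_doubleCharSum_le_of_odd hF hβ hlt
    rw [if_neg (by simp), zero_mul, zero_mul, neg_zero, sub_zero]
    refine h.trans ?_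
    gcongr
    norm_num
end

section
/- For the unitary symplectic group USp(2g) with Haar probability measure, the expected value of tr(U^n) equals 2g for n = 0, equals −1 for even n with 1 ≤ |n| ≤ 2g, equals 0 for odd n with 1 ≤ |n| ≤ 2g, and equals 0 for |n| > 2g. -/
open Matrix MeasureTheory

/-- The unitary symplectic group `USp(2g)`, realized as the subgroup of the
unitary group of `2g × 2g` complex matrices consisting of matrices preserving
the standard symplectic form `J`. -/
noncomputable def USp (g : ℕ) : Subgroup (Matrix.unitaryGroup (Fin g ⊕ Fin g) ℂ) where
  carrier := {U | (U : Matrix (Fin g ⊕ Fin g) (Fin g ⊕ Fin g) ℂ) ∈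
    Matrix.symplecticGroup (Fin g) ℂ}
  mul_mem' := by
    intro a b ha hb
    simpa using Submonoid.mul_mem _ ha hb
  one_mem' := by
    simpa using Submonoid.one_mem (Matrix.symplecticGroup (Fin g) ℂ)
  inv_mem' := by
    intro a ha
    have h1 : ((a⁻¹ : Matrix.unitaryGroup (Fin g ⊕ Fin g) ℂ) :
        Matrix (Fin g ⊕ Fin g) (Fin g ⊕ Fin g) ℂ) = (↑a)⁻¹ := by
      rw [Matrix.UnitaryGroup.inv_val,
        Matrix.inv_eq_left_inv (Matrix.UnitaryGroup.star_mul_self a)]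
    show ((a⁻¹ : Matrix.unitaryGroup (Fin g ⊕ Fin g) ℂ) :
        Matrix (Fin g ⊕ Fin g) (Fin g ⊕ Fin g) ℂ) ∈ Matrix.symplecticGroup (Fin g) ℂ
    rw [h1]
    have h2 := ((⟨(a : Matrix (Fin g ⊕ Fin g) (Fin g ⊕ Fin g) ℂ), ha⟩ :
      Matrix.symplecticGroup (Fin g) ℂ)⁻¹).2
    rwa [SymplecticGroup.coe_inv'] at h2

open Finset in
theorem Matrix.sum_prod_mul_comm {ι κ R : Type*} [Fintype ι] [Fintype κ] [DecidableEq κ]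
    [CommRing R] (A B : Matrix ι ι R) (σ : Equiv.Perm κ) :
    ∑ c : κ → ι, ∏ k, (A * B) (c (σ k)) (c k) = ∑ c : κ → ι, ∏ k, (B * A) (c (σ k)) (c k) := by
  have expand (A B : Matrix ι ι R) : ∑ c : κ → ι, ∏ k, (A * B) (c (σ k)) (c k) =
      ∑ c : κ → ι, ∑ d : κ → ι, (∏ k, A (c (σ k)) (d k)) * ∏ k, B (d k) (c k) := by
    refine sum_congr rfl fun c _ => ?_
    simp only [Matrix.mul_apply, ← prod_mul_distrib]
    rw [prod_univ_sum, Fintype.piFinset_univ]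
  rw [expand, expand, sum_comm]
  refine Fintype.sum_equiv (σ.arrowCongr (Equiv.refl ι)) _ _ fun d => ?_
  refine Fintype.sum_congr _ _ fun c => ?_
  rw [mul_comm]
  congr 1
  · exact prod_congr rfl fun k _ => by simp
  · rw [← Equiv.prod_comp σ (fun k => A (c k) _)]
    exact prod_congr rfl fun k _ => by simp

/-- The sum of the permanents of all `n × n` submatrices with equal row and column labels
(repetitions allowed). It equals `n!` times the trace of the `n`-th symmetric power. -/
noncomputable def Matrix.permanentSum {ι R : Type*} [Fintype ι] [CommRing R]
    (n : ℕ) (A : Matrix ι ι R) : R :=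
  ∑ c : Fin n → ι, (A.submatrix c c).permanent

theorem Matrix.permanentSum_mul_comm {ι R : Type*} [Fintype ι] [CommRing R]
    (n : ℕ) (A B : Matrix ι ι R) : permanentSum n (A * B) = permanentSum n (B * A) := by
  simp only [permanentSum, permanent, submatrix_apply]
  rw [Finset.sum_comm, Finset.sum_comm (γ := Fin n → ι)]
  exact Finset.sum_congr rfl fun σ _ => sum_prod_mul_comm A B σ

open Finset in
theorem sum_prod_factorial_card_mul_prod {ι : Type*} [Fintype ι] [DecidableEq ι] (n : ℕ)
    (l : ι → ℂ) :
    ∑ c : Fin n → ι, ((∏ i, (#{k | c k = i}).factorial : ℕ) : ℂ) * ∏ k, l (c k) =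
      n.factorial * ∑ d ∈ finsuppAntidiag univ n, ∏ i, l i ^ d i := by
  let φ : MvPolynomial ι ℂ →ₗ[ℂ] ℂ := (MvPolynomial.basisMonomials ι ℂ).constr ℂ
    fun d => ((∏ i, (d i).factorial : ℕ) : ℂ) * ∏ i, l i ^ d i
  have hφ (d : ι →₀ ℕ) : φ (MvPolynomial.monomial d 1) =
      ((∏ i, (d i).factorial : ℕ) : ℂ) * ∏ i, l i ^ d i := by
    rw [← congrFun (MvPolynomial.coe_basisMonomials ι ℂ) d, Module.Basis.constr_basis]
  have hpow : (∑ i, (MvPolynomial.X i : MvPolynomial ι ℂ)) ^ n =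
      ∑ c : Fin n → ι, ∏ k, MvPolynomial.X (c k) := by
    rw [← Fin.prod_const, prod_univ_sum, Fintype.piFinset_univ]
  have h := congrArg φ hpow
  rw [sum_pow_eq_sum_piAntidiag, map_sum, map_sum] at h
  rw [mul_sum]
  refine Eq.trans (sum_congr rfl fun c _ => ?_) (h.symm.trans ?_)
  · have : ∏ k, (MvPolynomial.X (c k) : MvPolynomial ι ℂ) =
        MvPolynomial.monomial (∑ k, Finsupp.single (c k) 1) 1 := by
      rw [MvPolynomial.monomial_sum_one]; rfl
    rw [this, hφ]
    have hc (i : ι) : (∑ k, Finsupp.single (c k) 1 : ι →₀ ℕ) i = #{k | c k = i} := by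
      rw [Finsupp.finsetSum_apply, card_filter]
      exact sum_congr rfl fun k _ => Finsupp.single_apply
    simp only [hc]
    congr 1
    rw [← prod_fiberwise univ c]
    refine prod_congr rfl fun i _ => ?_
    rw [prod_congr rfl fun k hk => by rw [(mem_filter.1 hk).2], prod_const]
  · refine (sum_bij (fun (d : ι →₀ ℕ) _ => (d : ι → ℕ)) (fun d hd => ?_)
      (fun _ _ _ _ h => DFunLike.coe_injective h)
      (fun d hd => ⟨Finsupp.equivFunOnFinite.symm d, ?_, rfl⟩) fun d hd => ?_).symm
    · simpa using (mem_finsuppAntidiag.1 hd).1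
    · simpa [mem_finsuppAntidiag] using (mem_piAntidiag.1 hd).1
    have hd' : ∏ i, (MvPolynomial.X i : MvPolynomial ι ℂ) ^ d i = MvPolynomial.monomial d 1 := by
      rw [MvPolynomial.monomial_eq, Finsupp.prod_fintype _ _ (by simp)]; simp
    have hs : ∑ i, d i = n := by simpa using (mem_finsuppAntidiag.1 hd).1
    have hm := Nat.multinomial_spec univ d
    rw [hs] at hm
    rw [hd', ← nsmul_eq_mul (Nat.multinomial univ d), map_nsmul, hφ, nsmul_eq_mul,
      ← mul_assoc, ← hm]
    push_cast
    ring

open Finset in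
theorem Matrix.permanentSum_diagonal {ι : Type*} [Fintype ι] [DecidableEq ι] (n : ℕ)
    (l : ι → ℂ) :
    permanentSum n (diagonal l) =
      n.factorial * PowerSeries.coeff n (∏ i, PowerSeries.mk fun m => l i ^ m) := by
  rw [PowerSeries.coeff_prod]
  simp only [PowerSeries.coeff_mk]
  rw [← sum_prod_factorial_card_mul_prod, permanentSum]
  refine sum_congr rfl fun c _ => ?_
  have hstab := DomMulAct.stabilizer_card c
  simp only [Fintype.card_subtype] at hstab
  rw [← hstab, permanent, card_eq_sum_ones, Nat.cast_sum, sum_mul, sum_filter]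
  refine sum_congr rfl fun σ _ => ?_
  split_ifs with h
  · rw [Nat.cast_one, one_mul]
    refine prod_congr rfl fun k _ => ?_
    have := congrFun h k
    simp only [Function.comp_apply] at this
    simp [this]
  · obtain ⟨k, hk⟩ := Function.ne_iff.1 h
    exact prod_eq_zero (mem_univ k) (by simpa using diagonal_apply_ne _ hk)

/-- The `k`-th elementary symmetric function of the eigenvalues of a matrix. -/
noncomputable def Matrix.esymmCoeff {ι R : Type*} [Fintype ι] [DecidableEq ι] [CommRing R]
    (k : ℕ) (A : Matrix ι ι R) : R :=
  (det (1 + (Polynomial.X : Polynomial R) • A.map Polynomial.C)).coeff k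

theorem Matrix.esymmCoeff_eq_sum_minors {ι R : Type*} [Fintype ι] [DecidableEq ι] [CommRing R]
    (k : ℕ) (A : Matrix ι ι R) : esymmCoeff k A =
      ∑ s ∈ Finset.univ.powersetCard k,
        (A.submatrix (Subtype.val : s → ι) (Subtype.val : s → ι)).det :=
  coeff_det_one_add_X_smul_eq_sum_minors A k

/-- The `k`-th complete homogeneous symmetric function of the eigenvalues of a matrix. -/
noncomputable def Matrix.hsymmCoeff {ι : Type*} [Fintype ι] (k : ℕ) (A : Matrix ι ι ℂ) : ℂ :=
  (k.factorial : ℂ)⁻¹ * permanentSum k A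

section Diagonalizable

variable {ι : Type*} [Fintype ι] [DecidableEq ι] {A P Q : Matrix ι ι ℂ} {l : ι → ℂ}

theorem Matrix.hsymmCoeff_eq_of_diagonalization (hPQ : Q * P = 1)
    (hA : A = P * diagonal l * Q) (k : ℕ) :
    hsymmCoeff k A = PowerSeries.coeff k (∏ i, PowerSeries.mk fun m => l i ^ m) := by
  rw [hsymmCoeff, hA, permanentSum_mul_comm, ← Matrix.mul_assoc, hPQ, Matrix.one_mul,
    permanentSum_diagonal, inv_mul_cancel_left₀]
  exact_mod_cast k.factorial_ne_zero

theorem Matrix.esymmCoeff_eq_of_diagonalization (hPQ : Q * P = 1)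
    (hA : A = P * diagonal l * Q) (k : ℕ) :
    esymmCoeff k A = (∏ i, (1 + Polynomial.C (l i) * Polynomial.X)).coeff k := by
  have hQP : P * Q = 1 := mul_eq_one_comm.1 hPQ
  have h1 : (1 + (Polynomial.X : Polynomial ℂ) • A.map Polynomial.C) =
      P.map Polynomial.C * (1 + (Polynomial.X : Polynomial ℂ) • (diagonal l).map Polynomial.C) *
        Q.map Polynomial.C := by
    have h2 : P.map Polynomial.C * Q.map Polynomial.C = 1 := by
      rw [← Matrix.map_mul, hQP]
      exact Matrix.map_one _ (map_zero _) (map_one _)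
    rw [hA, Matrix.map_mul, Matrix.map_mul, Matrix.mul_add, Matrix.add_mul, Matrix.mul_one, h2]
    rw [Matrix.mul_smul, Matrix.smul_mul]
  have h3 : (Q.map Polynomial.C).det * (P.map Polynomial.C).det = 1 := by
    rw [← det_mul, ← Matrix.map_mul, hPQ, Matrix.map_one _ (map_zero _) (map_one _), det_one]
  rw [esymmCoeff, h1, det_mul, det_mul, mul_comm, ← mul_assoc, h3, one_mul]
  congr 1
  have : (1 + (Polynomial.X : Polynomial ℂ) • (diagonal l).map Polynomial.C) =
      diagonal fun i => 1 + Polynomial.C (l i) * Polynomial.X := by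
    ext1 i j
    by_cases h : i = j
    · subst h; simp
    · simp [h]
  rw [this, det_diagonal]

theorem Matrix.trace_pow_eq_of_diagonalization (hPQ : Q * P = 1)
    (hA : A = P * diagonal l * Q) (k : ℕ) : trace (A ^ k) = ∑ i, l i ^ k := by
  have h : A ^ k = P * diagonal l ^ k * Q := by
    induction k with
    | zero => simp [mul_eq_one_comm.1 hPQ]
    | succ k ih =>
      rw [pow_succ, ih, hA, pow_succ]
      simp only [Matrix.mul_assoc]
      rw [← Matrix.mul_assoc Q P, hPQ, Matrix.one_mul]
  rw [h, trace_mul_comm, ← Matrix.mul_assoc, hPQ, Matrix.one_mul, diagonal_pow, trace_diagonal]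
  rfl

theorem PowerSeries.mk_pow_mul_one_sub (a : ℂ) :
    (PowerSeries.mk fun m => a ^ m) * (1 - C a * X) = 1 := by
  ext n
  cases n with
  | zero => simp [mul_sub]
  | succ n =>
    rw [mul_sub, mul_one, mul_left_comm, map_sub, coeff_C_mul, coeff_succ_mul_X]
    simp [pow_succ', PowerSeries.coeff_one]

omit [DecidableEq ι] in
open Finset in
theorem PowerSeries.coeff_prod_one_sub (l : ι → ℂ) (k : ℕ) :
    coeff k (∏ i, (1 - C (l i) * X) : PowerSeries ℂ) =
      (-1) ^ k * (∏ i, (1 + Polynomial.C (l i) * Polynomial.X)).coeff k := by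
  have : (∏ i, (1 - C (l i) * X) : PowerSeries ℂ) =
      evalNegHom ((∏ i, (1 + Polynomial.C (l i) * Polynomial.X) : Polynomial ℂ) :
        PowerSeries ℂ) := by
    rw [← Polynomial.coeToPowerSeries.ringHom_apply, map_prod, map_prod]
    refine prod_congr rfl fun i _ => ?_
    ext n
    rcases n with _ | _ | n <;> simp [evalNegHom, coeff_one, coeff_C]
  rw [this, evalNegHom, coeff_rescale, Polynomial.coeff_coe]

open Finset in
theorem Matrix.sum_esymmCoeff_mul_hsymmCoeff (hPQ : Q * P = 1)
    (hA : A = P * diagonal l * Q) (m : ℕ) :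
    ∑ x ∈ antidiagonal (m + 1), (-1) ^ x.1 * (esymmCoeff x.1 A * hsymmCoeff x.2 A) = 0 := by
  have h : (∏ i, (1 - PowerSeries.C (l i) * PowerSeries.X)) *
      (∏ i, PowerSeries.mk fun m => l i ^ m) = (1 : PowerSeries ℂ) := by
    rw [← prod_mul_distrib]
    exact prod_eq_one fun i _ => by rw [mul_comm, PowerSeries.mk_pow_mul_one_sub]
  have h' := congrArg (PowerSeries.coeff (m + 1)) h
  rw [PowerSeries.coeff_mul, PowerSeries.coeff_one, if_neg (Nat.succ_ne_zero m)] at h'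
  rw [← h']
  refine sum_congr rfl fun x _ => ?_
  rw [esymmCoeff_eq_of_diagonalization hPQ hA, hsymmCoeff_eq_of_diagonalization hPQ hA,
    PowerSeries.coeff_prod_one_sub]
  ring

open Finset in
theorem Matrix.trace_pow_succ_eq_sum (hPQ : Q * P = 1)
    (hA : A = P * diagonal l * Q) (m : ℕ) :
    trace (A ^ (m + 1)) = ∑ x ∈ antidiagonal m,
      (-1) ^ x.1 * (x.1 + 1) * (esymmCoeff (x.1 + 1) A * hsymmCoeff x.2 A) := by
  let G (i : ι) : PowerSeries ℂ := PowerSeries.mk fun m => l i ^ m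
  let L (i : ι) : PowerSeries ℂ := 1 - PowerSeries.C (l i) * PowerSeries.X
  have hLG (i : ι) : L i * G i = 1 := by rw [mul_comm]; exact PowerSeries.mk_pow_mul_one_sub _
  have hd (i : ι) : PowerSeries.derivative ℂ (L i) = - PowerSeries.C (l i) := by
    simp [L, PowerSeries.derivative_C]
  have hlog : -(PowerSeries.derivative ℂ (∏ i, L i)) * ∏ i, G i =
      ∑ i, PowerSeries.C (l i) * G i := by
    induction (univ : Finset ι) using Finset.induction_on with
    | empty => simp
    | insert a s ha ih =>
      have h1 : (∏ i ∈ s, L i) * ∏ i ∈ s, G i = 1 := by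
        rw [← prod_mul_distrib]
        exact prod_eq_one fun i _ => hLG i
      rw [prod_insert ha, prod_insert ha, sum_insert ha, ← ih, Derivation.leibniz, hd]
      simp only [smul_eq_mul]
      linear_combination (PowerSeries.C (l a) * G a) * h1 -
        (PowerSeries.derivative ℂ (∏ i ∈ s, L i) * ∏ i ∈ s, G i) * hLG a
  have h := congrArg (PowerSeries.coeff m) hlog
  rw [PowerSeries.coeff_mul, map_sum] at h
  rw [trace_pow_eq_of_diagonalization hPQ hA]
  refine (sum_congr rfl fun i _ => ?_).trans (h.symm.trans (sum_congr rfl fun x _ => ?_))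
  · rw [PowerSeries.coeff_C_mul, PowerSeries.coeff_mk, pow_succ']
  · rw [esymmCoeff_eq_of_diagonalization hPQ hA, hsymmCoeff_eq_of_diagonalization hPQ hA,
      map_neg, PowerSeries.coeff_derivative, PowerSeries.coeff_prod_one_sub]
    ring

end Diagonalizable

open Module.End in
theorem Matrix.exists_diagonalization_of_mem_unitaryGroup {ι : Type*} [Fintype ι] [DecidableEq ι]
    {A : Matrix ι ι ℂ} (hA : A ∈ unitaryGroup ι ℂ) :
    ∃ (P Q : Matrix ι ι ℂ) (l : ι → ℂ), Q * P = 1 ∧ A = P * diagonal l * Q := by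
  let T := toEuclideanLin (𝕜 := ℂ) (m := ι) (n := ι)
  have hS : (T (A + star A)).IsSymmetric := by
    rw [isSymmetric_toEuclideanLin_iff]
    simp [IsHermitian, star_eq_conjTranspose, add_comm]
  have hD : (T (Complex.I • (A - star A))).IsSymmetric := by
    rw [isSymmetric_toEuclideanLin_iff]
    simp only [IsHermitian, star_eq_conjTranspose, conjTranspose_smul, conjTranspose_sub,
      conjTranspose_conjTranspose]
    rw [← neg_sub, smul_neg, ← neg_smul]
    simp
  have hC : Commute (T (A + star A)) (T (Complex.I • (A - star A))) := by
    have h1 : A * star A = 1 := (mem_unitaryGroup_iff).1 hA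
    have h2 : star A * A = 1 := (mem_unitaryGroup_iff').1 hA
    have : Commute (A + star A) (Complex.I • (A - star A)) := by
      refine Commute.smul_right ?_ _
      simp only [Commute, SemiconjBy, mul_sub, add_mul, mul_add, sub_mul, h1, h2]
      abel
    exact this.map (toLpLinAlgEquiv (R := ℂ) (n := ι) 2)
  have htop := LinearMap.IsSymmetric.iSup_iSup_eigenspace_inf_eigenspace_eq_top_of_commute hS hD hC
  let s : Set (EuclideanSpace ℂ ι) := {v | ∃ c : ℂ, T A v = c • v}
  have hs : ⊤ ≤ Submodule.span ℂ s := by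
    rw [← htop]
    refine iSup_le fun a => iSup_le fun b v hv => Submodule.subset_span ?_
    rw [Submodule.mem_inf, mem_eigenspace_iff, mem_eigenspace_iff] at hv
    refine ⟨(a - Complex.I * b) / 2, ?_⟩
    have h1 := hv.1
    have h2 := hv.2
    simp only [map_add, map_smul, map_sub, LinearMap.add_apply, LinearMap.sub_apply,
      LinearMap.smul_apply] at h1 h2
    have h3 : (T A) v - (T (star A)) v = -(Complex.I * b) • v := by
      rw [neg_smul, mul_smul, ← h2, smul_smul, Complex.I_mul_I, neg_smul, one_smul, neg_neg]
    have h4 : (2 : ℂ) • T A v = (a - Complex.I * b) • v := by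
      rw [sub_eq_add_neg, add_smul, ← h1, ← h3]
      module
    rw [div_eq_inv_mul, mul_smul, ← h4, smul_smul]
    simp
  let b := Module.Basis.ofSpan hs
  have : Fintype ((linearIndepOn_empty ℂ id).extend (Set.empty_subset s)) :=
    Module.Basis.fintypeIndexOfRankLtAleph0 b (Module.rank_lt_aleph0 ℂ _)
  have hcard : Fintype.card ((linearIndepOn_empty ℂ id).extend (Set.empty_subset s)) =
      Fintype.card ι := by
    rw [← Module.finrank_eq_card_basis b, finrank_euclideanSpace]
  let c := b.reindex (Fintype.equivOfCardEq hcard)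
  have hc (i : ι) : ∃ l : ℂ, T A (c i) = l • c i := by
    rw [Module.Basis.reindex_apply]
    exact Module.Basis.ofSpan_subset hs (Set.mem_range_self _)
  choose l hl using hc
  let e := (EuclideanSpace.basisFun ι ℂ).toBasis
  have hP : e.toMatrix c * c.toMatrix e = 1 := e.toMatrix_mul_toMatrix_flip c
  refine ⟨e.toMatrix c, c.toMatrix e, l, c.toMatrix_mul_toMatrix_flip e, ?_⟩
  have hAP : A * e.toMatrix c = e.toMatrix c * diagonal l := by
    ext i j
    rw [mul_diagonal, mul_comm]
    have := congrFun (congrArg WithLp.ofLp (hl j)) i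
    simpa [T, e, mul_apply, mulVec, dotProduct, Module.Basis.toMatrix_apply] using this
  rw [← hAP, Matrix.mul_assoc, hP, Matrix.mul_one]

namespace USp

variable {g : ℕ} [MeasurableSpace (USp g)]

/-- The expectation of a function of the underlying matrix of an element of `USp(2g)`. -/
noncomputable def expect (μ : Measure (USp g))
    (F : Matrix (Fin g ⊕ Fin g) (Fin g ⊕ Fin g) ℂ → ℂ) : ℂ :=
  ∫ U : USp g, F U.1.1 ∂μ

variable {μ : Measure (USp g)} {F G : Matrix (Fin g ⊕ Fin g) (Fin g ⊕ Fin g) ℂ → ℂ}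

theorem expect_congr (μ : Measure (USp g)) (h : ∀ U : USp g, F U.1.1 = G U.1.1) :
    expect μ F = expect μ G :=
  integral_congr_ae (ae_of_all _ h)

theorem expect_const_mul (c : ℂ) : expect μ (fun M => c * F M) = c * expect μ F :=
  integral_const_mul c _

variable [IsProbabilityMeasure μ]

theorem expect_const (c : ℂ) : expect μ (fun _ => c) = c := by
  simp [expect]

variable [BorelSpace (USp g)]

theorem integrable_coe (μ : Measure (USp g)) [IsProbabilityMeasure μ] (hF : Continuous F) :
    Integrable (fun U : USp g => F U.1.1) μ := by
  let K : Set (Matrix (Fin g ⊕ Fin g) (Fin g ⊕ Fin g) ℂ) :=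
    Set.pi Set.univ fun _ => Set.pi Set.univ fun _ => Metric.closedBall 0 1
  have hK : IsCompact K := isCompact_univ_pi fun _ => isCompact_univ_pi fun _ =>
    isCompact_closedBall 0 1
  obtain ⟨C, hC⟩ := hK.exists_bound_of_continuousOn hF.continuousOn
  refine Integrable.of_bound (C := C) ?_ (ae_of_all _ fun U => hC _ ?_)
  · exact (hF.comp (continuous_subtype_val.comp continuous_subtype_val)).aestronglyMeasurable
  · intro i _ j _
    simpa using entry_norm_bound_of_unitary U.1.2 i j

theorem expect_sum {κ : Type*} {s : Finset κ}
    {F : κ → Matrix (Fin g ⊕ Fin g) (Fin g ⊕ Fin g) ℂ → ℂ} (hF : ∀ k ∈ s, Continuous (F k)) :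
    expect μ (fun M => ∑ k ∈ s, F k M) = ∑ k ∈ s, expect μ (F k) :=
  integral_finsetSum _ fun k hk => integrable_coe μ (hF k hk)

theorem expect_mul_left (hinv : ∀ A : USp g, Measure.map (fun U => A * U) μ = μ)
    (hF : Continuous F) {A : Matrix (Fin g ⊕ Fin g) (Fin g ⊕ Fin g) ℂ}
    (hA : A ∈ unitaryGroup (Fin g ⊕ Fin g) ℂ) (hA' : A ∈ symplecticGroup (Fin g) ℂ) :
    expect μ (fun M => F (A * M)) = expect μ F := by
  let B : USp g := ⟨⟨A, hA⟩, hA'⟩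
  have hc : Continuous fun U : USp g => B * U := by
    refine Continuous.subtype_mk (Continuous.subtype_mk ?_ _) _
    exact continuous_const.mul (continuous_subtype_val.comp continuous_subtype_val)
  have h := integral_map (μ := μ) (φ := fun U => B * U) hc.aemeasurable
    (f := fun U : USp g => F U.1.1) (by rw [hinv]; exact (integrable_coe μ hF).1)
  rw [hinv] at h
  exact h.symm

/-- If left multiplication by an element of `USp(2g)` scales `F` by `-1`, then `F` has mean zero. -/
theorem expect_eq_zero_of_mul_left (hinv : ∀ A : USp g, Measure.map (fun U => A * U) μ = μ)
    (hF : Continuous F) {A : Matrix (Fin g ⊕ Fin g) (Fin g ⊕ Fin g) ℂ}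
    (hA : A ∈ unitaryGroup (Fin g ⊕ Fin g) ℂ) (hA' : A ∈ symplecticGroup (Fin g) ℂ)
    (h : ∀ M, F (A * M) = -1 * F M) : expect μ F = 0 := by
  have h1 := expect_mul_left hinv hF hA hA'
  simp only [h, expect_const_mul] at h1
  linear_combination (-1 / 2 : ℂ) * h1

end USp

section Elements

variable {l : Type*} [Fintype l] [DecidableEq l]

theorem Matrix.mem_symplecticGroup_of_mem_unitaryGroup {A C : Matrix l l ℂ}
    (hA : fromBlocks A (-C.map star) C (A.map star) ∈ unitaryGroup (l ⊕ l) ℂ) :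
    fromBlocks A (-C.map star) C (A.map star) ∈ symplecticGroup l ℂ := by
  set M := fromBlocks A (-C.map star) C (A.map star) with hM
  have h : M * J l ℂ = J l ℂ * M.map star := by
    have hA' : (A.map star).map star = A := by ext; simp
    have hC' : (-C.map star).map star = -C := by ext; simp
    rw [hM, J, fromBlocks_multiply, fromBlocks_map, fromBlocks_multiply, hA', hC']
    simp
  have h1 : M.map star * Mᵀ = 1 := by
    have := congrArg (fun M => M.map star) (mem_unitaryGroup_iff.1 hA)
    have h2 : (M * star M).map star = M.map star * Mᵀ := by
      ext i j
      simp [mul_apply, star_apply]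
    rw [h2] at this
    rw [this]
    exact Matrix.map_one _ (star_zero _) (star_one _)
  rw [SymplecticGroup.mem_iff, h, Matrix.mul_assoc, h1, Matrix.mul_one]

theorem Matrix.fromBlocks_mem_unitaryGroup {W : Matrix l l ℂ} (hW : W ∈ unitaryGroup l ℂ) :
    fromBlocks W 0 0 (W.map star) ∈ unitaryGroup (l ⊕ l) ℂ := by
  have h := mem_unitaryGroup_iff.1 hW
  rw [star_eq_conjTranspose] at h
  have h' : W.map star * (W.map star)ᴴ = 1 := by
    have := congrArg (fun M => M.map star) h
    have h2 : (W * Wᴴ).map star = W.map star * (W.map star)ᴴ := by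
      ext i j
      simp [mul_apply, conjTranspose_apply]
    rw [← h2, h]
    exact Matrix.map_one _ (star_zero _) (star_one _)
  rw [mem_unitaryGroup_iff, star_eq_conjTranspose, fromBlocks_conjTranspose, fromBlocks_multiply,
    h, h']
  simp

theorem Matrix.fromBlocks_mem_symplecticGroup {W : Matrix l l ℂ} (hW : W ∈ unitaryGroup l ℂ) :
    fromBlocks W 0 0 (W.map star) ∈ symplecticGroup l ℂ := by
  have h := fromBlocks_mem_unitaryGroup hW
  have h0 : (0 : Matrix l l ℂ) = -(0 : Matrix l l ℂ).map star := by ext; simp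
  nth_rewrite 1 [h0] at h ⊢
  exact mem_symplecticGroup_of_mem_unitaryGroup h

theorem Matrix.diagonal_mem_unitaryGroup {u : l → ℂ} (hu : ∀ k, u k * star (u k) = 1) :
    diagonal u ∈ unitaryGroup l ℂ := by
  rw [mem_unitaryGroup_iff, star_eq_conjTranspose, diagonal_conjTranspose, diagonal_mul_diagonal,
    ← diagonal_one]
  congr 1
  ext k
  exact hu k

theorem Matrix.submatrix_one_mem_unitaryGroup (σ : Equiv.Perm l) :
    (1 : Matrix l l ℂ).submatrix σ id ∈ unitaryGroup l ℂ := by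
  rw [mem_unitaryGroup_iff, star_eq_conjTranspose, conjTranspose_submatrix, conjTranspose_one,
    ← submatrix_mul _ _ _ _ _ Function.bijective_id, Matrix.mul_one]
  exact submatrix_one_equiv σ

omit [Fintype l] in
theorem Matrix.fromBlocks_submatrix_one (π : Equiv.Perm l) :
    fromBlocks ((1 : Matrix l l ℂ).submatrix π id) 0 0
      (((1 : Matrix l l ℂ).submatrix π id).map star) =
      (1 : Matrix (l ⊕ l) (l ⊕ l) ℂ).submatrix (Sum.map π π) id := by
  ext (x | x) (y | y) <;> simp [one_apply, apply_ite]

theorem Matrix.exists_mem_unitaryGroup_row_eq (k₀ : l) {v : l → ℂ}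
    (hv : ∑ k, v k * star (v k) = 1) : ∃ W ∈ unitaryGroup l ℂ, ∀ k, W k₀ k = v k := by
  let w : l → EuclideanSpace ℂ l := fun _ => WithLp.toLp 2 v
  have hw : Orthonormal ℂ (({k₀} : Set l).domRestrict w) := by
    rw [orthonormal_iff_ite]
    rintro ⟨i, rfl⟩ ⟨j, rfl⟩
    rw [if_pos rfl, ← hv]
    simp only [Set.domRestrict_apply, w, PiLp.inner_apply, RCLike.inner_apply, Complex.star_def]
  obtain ⟨b, hb⟩ := hw.exists_orthonormalBasis_extension_of_card_eq finrank_euclideanSpace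
  refine ⟨of fun i j => b i j, ?_, fun k => ?_⟩
  · rw [mem_unitaryGroup_iff, star_eq_conjTranspose]
    ext i j
    have := orthonormal_iff_ite.1 b.orthonormal j i
    simpa [mul_apply, one_apply, eq_comm, PiLp.inner_apply] using this
  · simp [hb k₀ rfl, w]

theorem Matrix.exists_mem_unitaryGroup_and_symplecticGroup_row_eq (k₀ : l) {v : l ⊕ l → ℝ}
    (hv : ∑ k, v k ^ 2 = 1) : ∃ A : Matrix (l ⊕ l) (l ⊕ l) ℂ, A ∈ unitaryGroup (l ⊕ l) ℂ ∧
      A ∈ symplecticGroup l ℂ ∧ ∀ x, A (Sum.inl k₀) x = v x := by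
  obtain ⟨W, hW, hrow⟩ := exists_mem_unitaryGroup_row_eq k₀
    (v := fun k => (v (.inl k) : ℂ) - v (.inr k) * Complex.I) (by
      rw [Fintype.sum_sum_type, ← Finset.sum_add_distrib] at hv
      rw [← Complex.ofReal_one, ← hv, Complex.ofReal_sum]
      refine Finset.sum_congr rfl fun k _ => ?_
      apply Complex.ext <;> simp [-Complex.ofReal_pow] <;> ring)
  let X : Matrix l l ℂ := W.map fun z => (z.re : ℂ)
  let Y : Matrix l l ℂ := W.map fun z => (z.im : ℂ)
  have hX : X.map star = X := by ext; simp [X]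
  have hY : Y.map star = Y := by ext; simp [Y]
  have hXY (i j) : (∑ k, W i k * star (W j k)) = (1 : Matrix l l ℂ) i j := by
    rw [← mem_unitaryGroup_iff.1 hW]
    simp [mul_apply, star_apply]
  have h1 : X * Xᵀ + Y * Yᵀ = 1 := by
    ext i j
    have h := congrArg Complex.re (hXY i j)
    have h' : (1 : Matrix l l ℂ) i j = ((1 : Matrix l l ℂ) i j).re := by
      rw [one_apply]; split_ifs <;> simp
    rw [h', ← h]
    simp [X, Y, mul_apply, Finset.sum_add_distrib]
  have h2 : X * Yᵀ = Y * Xᵀ := by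
    ext i j
    have h := congrArg Complex.im (hXY i j)
    have h' : ((1 : Matrix l l ℂ) i j).im = 0 := by
      rw [one_apply]; split_ifs <;> simp
    rw [h'] at h
    have h3 : ∑ k, (W i k).re * (W j k).im = ∑ k, (W i k).im * (W j k).re := by
      simp [Finset.sum_add_distrib] at h
      linarith
    simp only [X, Y, mul_apply, map_apply, transpose_apply]
    exact_mod_cast congrArg Complex.ofReal h3
  have hU : fromBlocks X (-Y.map star) Y (X.map star) ∈ unitaryGroup (l ⊕ l) ℂ := by
    rw [hX, hY, mem_unitaryGroup_iff, star_eq_conjTranspose, fromBlocks_conjTranspose,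
      fromBlocks_multiply]
    have hX' : Xᴴ = Xᵀ := by ext; simp [X]
    have hY' : Yᴴ = Yᵀ := by ext; simp [Y]
    simp [hX', hY', h1, h2, add_comm (Y * Yᵀ)]
  refine ⟨_, hU, mem_symplecticGroup_of_mem_unitaryGroup hU, ?_⟩
  rintro (k | k)
  · simp [X, hrow]
  · simp [Y, hrow]

end Elements

section Minors

variable {ι α R : Type*} [Fintype ι] [DecidableEq ι] [Fintype α] [DecidableEq α] [CommRing R]

theorem Matrix.det_submatrix_diagonal_mul (d : ι → R) (M : Matrix ι ι R) (a b : α → ι) :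
    ((diagonal d * M).submatrix a b).det = (∏ k, d (a k)) * (M.submatrix a b).det := by
  rw [← det_mul_column]
  congr 1
  ext i j
  simp [diagonal_mul]

omit [DecidableEq ι] in
theorem Matrix.det_submatrix_mul_eq_sum (A M : Matrix ι ι R) (a b : α → ι) :
    ((A * M).submatrix a b).det =
      ∑ p : α → ι, (∏ k, A (a k) (p k)) * (M.submatrix p b).det := by
  have h : (A * M).submatrix a b = fun i => ∑ x, A (a i) x • fun j => M x (b j) := by
    ext i j
    simp [mul_apply]
  rw [h]
  refine (MultilinearMap.map_sum (detRowAlternating (R := R) (n := α)).toMultilinearMap _).trans ?_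
  refine Fintype.sum_congr _ _ fun p => ?_
  exact MultilinearMap.map_smul_univ _ _ _

open Finset in
/-- Ryser's formula. -/
theorem Matrix.permanent_eq_sum_finset (X : Matrix α α R) :
    X.permanent = ∑ S : Finset α, (-1) ^ #S * ∏ k, ∑ i ∈ Sᶜ, X i k := by
  have h (S : Finset α) : (-1) ^ #S * ∏ k, ∑ i ∈ Sᶜ, X i k =
      ∑ f : α → α, if S ∈ (univ.image f)ᶜ.powerset then (-1) ^ #S * ∏ k, X (f k) k else 0 := by
    rw [prod_univ_sum, mul_sum, ← sum_filter]
    refine sum_congr ?_ fun _ _ => rfl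
    ext f
    simp only [Fintype.mem_piFinset, mem_compl, mem_filter, mem_univ, true_and, mem_powerset,
      subset_iff, mem_image, not_exists]
    exact ⟨fun h x hx k hk => h k (hk ▸ hx), fun h k hk => h hk k rfl⟩
  simp only [h]
  rw [sum_comm]
  have h2 (f : α → α) : (∑ S : Finset α,
      if S ∈ (univ.image f)ᶜ.powerset then (-1) ^ #S * ∏ k, X (f k) k else 0) =
      if Function.Bijective f then ∏ k, X (f k) k else 0 := by
    rw [← sum_filter, filter_mem_eq_inter, univ_inter, ← sum_mul]
    have := congrArg (Int.cast : ℤ → R) (sum_powerset_neg_one_pow_card (x := (univ.image f)ᶜ))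
    push_cast at this
    have hf : (univ.image f)ᶜ = ∅ ↔ Function.Bijective f := by
      rw [compl_eq_empty_iff, ← coe_eq_univ, coe_image, coe_univ, Set.image_univ,
        Set.range_eq_univ, ← Finite.injective_iff_surjective,
        Finite.injective_iff_bijective]
    rw [this]
    simp only [hf]
    split_ifs <;> simp
  simp only [h2]
  rw [← sum_filter, permanent]
  refine sum_bij (fun (σ : Equiv.Perm α) _ => (σ : α → α)) (fun σ _ => by simp)
    (fun _ _ _ _ h => DFunLike.coe_injective h)
    (fun f hf => ⟨Equiv.ofBijective f (mem_filter.1 hf).2, mem_univ _, rfl⟩) fun _ _ => rfl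

end Minors

namespace USp

variable {g : ℕ} {α κ : Type*} [Fintype α] [DecidableEq α] [Fintype κ]

theorem continuous_det_submatrix (a b : α → Fin g ⊕ Fin g) :
    Continuous fun M : Matrix (Fin g ⊕ Fin g) (Fin g ⊕ Fin g) ℂ => (M.submatrix a b).det :=
  (continuous_id.matrix_submatrix a b).matrix_det

theorem continuous_prod_entry (x : κ → Fin g ⊕ Fin g) (d : κ → Fin g ⊕ Fin g) :
    Continuous fun M : Matrix (Fin g ⊕ Fin g) (Fin g ⊕ Fin g) ℂ => ∏ k, M (x k) (d k) :=
  continuous_finsetProd _ fun k _ => continuous_id.matrix_elem (x k) (d k)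

theorem continuous_permanent_submatrix [DecidableEq κ] (c d : κ → Fin g ⊕ Fin g) :
    Continuous fun M : Matrix (Fin g ⊕ Fin g) (Fin g ⊕ Fin g) ℂ =>
      (M.submatrix c d).permanent :=
  continuous_finsetSum _ fun σ _ => continuous_prod_entry (fun k => c (σ k)) d

theorem continuous_esymmCoeff (i : ℕ) :
    Continuous fun M : Matrix (Fin g ⊕ Fin g) (Fin g ⊕ Fin g) ℂ =>
      esymmCoeff i M := by
  simp only [esymmCoeff_eq_sum_minors]
  exact continuous_finsetSum _ fun s _ => continuous_det_submatrix _ _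

theorem continuous_hsymmCoeff (i : ℕ) :
    Continuous fun M : Matrix (Fin g ⊕ Fin g) (Fin g ⊕ Fin g) ℂ =>
      hsymmCoeff i M :=
  continuous_const.mul (continuous_finsetSum _ fun c _ => continuous_permanent_submatrix c c)

open Finset in
theorem exists_zpow_eq_prod (k₀ : Fin g) (s : Finset (Fin g ⊕ Fin g)) :
    ∃ z : ℤ, -1 ≤ z ∧ ∀ t : ℂ, t ≠ 0 → ∏ x ∈ s, Sum.elim (Function.update 1 k₀ t)
      (Function.update 1 k₀ t⁻¹) x = t ^ z := by
  refine ⟨(if .inl k₀ ∈ s then 1 else 0) - (if .inr k₀ ∈ s then 1 else 0), ?_, fun t ht => ?_⟩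
  · split_ifs <;> simp
  have h (x : Fin g ⊕ Fin g) : (Sum.elim (Function.update 1 k₀ t)
      (Function.update 1 k₀ t⁻¹) x : ℂ) =
      (if x = .inl k₀ then t else 1) * (if x = .inr k₀ then t⁻¹ else 1) := by
    rcases x with x | x <;> simp [Function.update_apply]
  simp only [h, prod_mul_distrib, prod_ite_eq']
  rw [zpow_sub₀ ht, div_eq_mul_inv]
  split_ifs <;> simp

variable [MeasurableSpace (USp g)] [BorelSpace (USp g)] {μ : Measure (USp g)}
  [IsProbabilityMeasure μ]

theorem expect_det_mul_prod_entry (hinv : ∀ A : USp g, Measure.map (fun U => A * U) μ = μ)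
    (hκ : 2 ≤ Fintype.card κ) (k₀ : Fin g) (a b : α → Fin g ⊕ Fin g) (d : κ → Fin g ⊕ Fin g) :
    expect μ (fun M => (M.submatrix a b).det * ∏ k, M (Sum.inl k₀) (d k)) = 0 := by
  by_cases ha : Function.Injective a
  swap
  · obtain ⟨i, j, hij, hne⟩ := Function.not_injective_iff.1 ha
    have h (M : Matrix (Fin g ⊕ Fin g) (Fin g ⊕ Fin g) ℂ) : (M.submatrix a b).det = 0 :=
      det_zero_of_row_eq hne (by ext; simp [hij])
    simp only [h, zero_mul, expect_const]
  obtain ⟨z, hz, hprod⟩ := exists_zpow_eq_prod k₀ (Finset.univ.image a)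
  have hN : ((z : ℂ) + Fintype.card κ) ≠ 0 := by
    have : z + Fintype.card κ ≠ 0 := by omega
    exact_mod_cast this
  obtain ⟨t, ht0, ht1, htN⟩ : ∃ t : ℂ, t ≠ 0 ∧ t * star t = 1 ∧
      t ^ (z + Fintype.card κ) = -1 := by
    refine ⟨Complex.exp ((Real.pi / (z + Fintype.card κ : ℝ) : ℝ) * Complex.I),
      Complex.exp_ne_zero _, ?_, ?_⟩
    · rw [Complex.star_def, Complex.mul_conj, Complex.normSq_eq_norm_sq,
        Complex.norm_exp_ofReal_mul_I]
      simp
    · rw [← Complex.exp_int_mul, ← Complex.exp_pi_mul_I]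
      congr 1
      push_cast
      field_simp
  have hstar : star t = t⁻¹ := eq_inv_of_mul_eq_one_right ht1
  let u : Fin g → ℂ := Function.update 1 k₀ t
  have hu (k) : u k * star (u k) = 1 := by
    by_cases hk : k = k₀
    · subst hk; simpa [u] using ht1
    · simp [u, hk]
  have hu' : (diagonal u).map star = diagonal (Function.update 1 k₀ t⁻¹) := by
    rw [diagonal_map (star_zero _)]
    congr 1
    ext k
    by_cases hk : k = k₀
    · subst hk; simp [u, ← hstar]
    · simp [u, hk]
  have hd := diagonal_mem_unitaryGroup hu
  refine expect_eq_zero_of_mul_left hinv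
    ((continuous_det_submatrix a b).mul (continuous_prod_entry _ d))
    (fromBlocks_mem_unitaryGroup hd) (fromBlocks_mem_symplecticGroup hd) fun M => ?_
  rw [hu', fromBlocks_diagonal, det_submatrix_diagonal_mul, ← htN, zpow_add₀ ht0,
    ← hprod t ht0, Finset.prod_image ha.injOn]
  simp only [diagonal_mul, Finset.prod_mul_distrib]
  simp [u]
  ring

theorem expect_det_mul_prod_unit (hg : 1 ≤ g)
    (hinv : ∀ A : USp g, Measure.map (fun U => A * U) μ = μ)
    (hκ : 2 ≤ Fintype.card κ) (a b : α → Fin g ⊕ Fin g) (d : κ → Fin g ⊕ Fin g)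
    {v : Fin g ⊕ Fin g → ℝ} (hv : ∑ x, v x ^ 2 = 1) :
    expect μ (fun M => (M.submatrix a b).det * ∏ k, ∑ x, (v x : ℂ) * M x (d k)) = 0 := by
  let k₀ : Fin g := ⟨0, hg⟩
  obtain ⟨A, hA, hA', hrow⟩ := exists_mem_unitaryGroup_and_symplecticGroup_row_eq k₀ hv
  let G (p : α → Fin g ⊕ Fin g) (M : Matrix (Fin g ⊕ Fin g) (Fin g ⊕ Fin g) ℂ) : ℂ :=
    (M.submatrix p b).det * ∏ k, M (Sum.inl k₀) (d k)
  have hG (p) : Continuous (G p) :=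
    (continuous_det_submatrix p b).mul (continuous_prod_entry _ d)
  have h (M : Matrix (Fin g ⊕ Fin g) (Fin g ⊕ Fin g) ℂ) :
      (M.submatrix a b).det * ∏ k, ∑ x, (v x : ℂ) * M x (d k) =
        ∑ p : α → Fin g ⊕ Fin g, (∏ k, (star A) (a k) (p k)) * G p (A * M) := by
    have hM : M = star A * (A * M) := by
      rw [← Matrix.mul_assoc, mem_unitaryGroup_iff'.1 hA, Matrix.one_mul]
    conv_lhs => rw [hM]
    rw [det_submatrix_mul_eq_sum, Finset.sum_mul, ← hM]
    refine Finset.sum_congr rfl fun p _ => ?_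
    rw [mul_assoc]
    simp only [G, Matrix.mul_apply (M := A) (N := M), hrow]
  simp only [h]
  rw [expect_mul_left (F := fun M => ∑ p : α → Fin g ⊕ Fin g, (∏ k, (star A) (a k) (p k)) * G p M)
    hinv (continuous_finsetSum _ fun p _ => continuous_const.mul (hG p)) hA hA', expect_sum]
  · refine Finset.sum_eq_zero fun p _ => ?_
    rw [expect_const_mul, expect_det_mul_prod_entry hinv hκ, mul_zero]
  · exact fun p _ => continuous_const.mul (hG p)

theorem expect_det_mul_prod_linear (hg : 1 ≤ g)
    (hinv : ∀ A : USp g, Measure.map (fun U => A * U) μ = μ)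
    (hκ : 2 ≤ Fintype.card κ) (a b : α → Fin g ⊕ Fin g) (d : κ → Fin g ⊕ Fin g)
    (v : Fin g ⊕ Fin g → ℝ) :
    expect μ (fun M => (M.submatrix a b).det * ∏ k, ∑ x, (v x : ℂ) * M x (d k)) = 0 := by
  by_cases hv : v = 0
  · have : Nonempty κ := Fintype.card_pos_iff.1 (by omega)
    simp [hv, expect_const]
  have hr : 0 < ∑ x, v x ^ 2 := by
    obtain ⟨x, hx⟩ := Function.ne_iff.1 hv
    exact Finset.sum_pos' (fun _ _ => sq_nonneg _) ⟨x, Finset.mem_univ _,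
      sq_pos_of_ne_zero hx⟩
  let r := Real.sqrt (∑ x, v x ^ 2)
  have hr0 : r ≠ 0 := (Real.sqrt_pos.2 hr).ne'
  have hunit : ∑ x, (v x / r) ^ 2 = 1 := by
    simp only [div_pow]
    rw [← Finset.sum_div, Real.sq_sqrt hr.le, div_self hr.ne']
  have h (M : Matrix (Fin g ⊕ Fin g) (Fin g ⊕ Fin g) ℂ) :
      (M.submatrix a b).det * ∏ k, ∑ x, (v x : ℂ) * M x (d k) = (r : ℂ) ^ Fintype.card κ *
        ((M.submatrix a b).det * ∏ k, ∑ x, ((v x / r : ℝ) : ℂ) * M x (d k)) := by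
    rw [mul_left_comm, ← Finset.card_univ, ← Finset.prod_const, ← Finset.prod_mul_distrib]
    congr 1
    refine Finset.prod_congr rfl fun k _ => ?_
    rw [Finset.mul_sum]
    refine Finset.sum_congr rfl fun x _ => ?_
    have : (r : ℂ) ≠ 0 := by exact_mod_cast hr0
    push_cast
    field_simp
  simp only [h]
  rw [expect_const_mul, expect_det_mul_prod_unit hg hinv hκ a b d hunit, mul_zero]

open Finset in
theorem expect_det_mul_permanent [DecidableEq κ] (hg : 1 ≤ g)
    (hinv : ∀ A : USp g, Measure.map (fun U => A * U) μ = μ)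
    (hκ : 2 ≤ Fintype.card κ) (a b : α → Fin g ⊕ Fin g) (c d : κ → Fin g ⊕ Fin g) :
    expect μ (fun M => (M.submatrix a b).det * (M.submatrix c d).permanent) = 0 := by
  have h (M : Matrix (Fin g ⊕ Fin g) (Fin g ⊕ Fin g) ℂ) :
      (M.submatrix a b).det * (M.submatrix c d).permanent = ∑ S : Finset κ, (-1) ^ #S *
        ((M.submatrix a b).det * ∏ k, ∑ x, ((#{i ∈ Sᶜ | c i = x} : ℝ) : ℂ) * M x (d k)) := by
    rw [permanent_eq_sum_finset, mul_sum]
    refine sum_congr rfl fun S _ => ?_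
    rw [mul_left_comm]
    congr 2
    refine prod_congr rfl fun k _ => ?_
    rw [← sum_fiberwise Sᶜ c]
    refine sum_congr rfl fun x _ => ?_
    rw [sum_congr rfl fun i hi => by rw [submatrix_apply, (mem_filter.1 hi).2], sum_const]
    simp
  simp only [h]
  rw [expect_sum]
  · refine sum_eq_zero fun S _ => ?_
    rw [expect_const_mul, expect_det_mul_prod_linear hg hinv hκ a b d, mul_zero]
  · refine fun S _ => continuous_const.mul ((continuous_det_submatrix a b).mul ?_)
    exact continuous_finsetProd _ fun k _ => continuous_finsetSum _ fun x _ =>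
      continuous_const.mul (continuous_id.matrix_elem x (d k))

theorem expect_esymmCoeff_mul_hsymmCoeff (hg : 1 ≤ g)
    (hinv : ∀ A : USp g, Measure.map (fun U => A * U) μ = μ) (i : ℕ) {j : ℕ} (hj : 2 ≤ j) :
    expect μ (fun M => esymmCoeff i M * hsymmCoeff j M) = 0 := by
  have hc (s : Finset (Fin g ⊕ Fin g)) (c : Fin j → Fin g ⊕ Fin g) :
      Continuous fun M : Matrix (Fin g ⊕ Fin g) (Fin g ⊕ Fin g) ℂ => (j.factorial : ℂ)⁻¹ *
        ((M.submatrix (Subtype.val : s → _) (Subtype.val : s → _)).det *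
          (M.submatrix c c).permanent) :=
    continuous_const.mul
      ((continuous_det_submatrix _ _).mul (continuous_permanent_submatrix c c))
  have h (M : Matrix (Fin g ⊕ Fin g) (Fin g ⊕ Fin g) ℂ) : esymmCoeff i M * hsymmCoeff j M =
      ∑ s ∈ Finset.univ.powersetCard i, ∑ c : Fin j → Fin g ⊕ Fin g, (j.factorial : ℂ)⁻¹ *
        ((M.submatrix (Subtype.val : s → _) (Subtype.val : s → _)).det *
          (M.submatrix c c).permanent) := by
    rw [esymmCoeff_eq_sum_minors, hsymmCoeff, permanentSum, mul_left_comm, Finset.sum_mul,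
      Finset.mul_sum]
    simp only [Finset.mul_sum]
  simp only [h]
  rw [expect_sum fun s _ => continuous_finsetSum _ fun c _ => hc s c]
  refine Finset.sum_eq_zero fun s _ => ?_
  rw [expect_sum fun c _ => hc s c]
  refine Finset.sum_eq_zero fun c _ => ?_
  rw [expect_const_mul, expect_det_mul_permanent hg hinv (by simpa using hj), mul_zero]

end USp

section SymplecticMinors

/-- The labelling of pairs of rows or columns of a `2 × 2` block matrix determined by a labelling
of the rows or columns of the blocks. -/
def Sum.doubling {κ l : Type*} (t : κ → l) (x : κ × Bool) : l ⊕ l :=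
  bif x.2 then .inr (t x.1) else .inl (t x.1)

theorem Sum.doubling_injective {κ l : Type*} {t : κ → l} (ht : Function.Injective t) :
    Function.Injective (Sum.doubling t) := by
  rintro ⟨k, _ | _⟩ ⟨k', _ | _⟩ h <;> simp_all [Sum.doubling, ht.eq_iff]

variable {κ l R : Type*} [Fintype κ] [DecidableEq κ] [Fintype l] [DecidableEq l] [CommRing R]

theorem Finset.sum_perm_bool {M : Type*} [AddCommMonoid M] (f : Equiv.Perm Bool → M) :
    ∑ ε, f ε = f 1 + f (Equiv.swap true false) := by
  have : (univ : Finset (Equiv.Perm Bool)) = {1, Equiv.swap true false} := by decide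
  rw [this, sum_pair (by decide)]

open Finset in
theorem Matrix.sum_det_submatrix_doubling (A : Matrix (κ × Bool) (l ⊕ l) R) :
    2 ^ Fintype.card κ * ∑ j : κ → l, (A.submatrix id (Sum.doubling j)).det =
      ∑ σ : Equiv.Perm (κ × Bool), (Equiv.Perm.sign σ : ℤ) *
        ∏ k, (A * J l R * Aᵀ) (σ (k, true)) (σ (k, false)) := by
  have hJ (x y : κ × Bool) : (A * J l R * Aᵀ) x y = ∑ j : l, ∑ ε : Equiv.Perm Bool,
      (Equiv.Perm.sign ε : ℤ) * (A (bif ε true then x else y) (.inr j) *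
        A (bif ε false then x else y) (.inl j)) := by
    simp [Finset.sum_perm_bool, J, mul_apply, one_apply, sum_add_distrib, mul_comm (A y (Sum.inr _))]
  have hε (σ : Equiv.Perm (κ × Bool)) (k : κ) (b : Bool) :
      (bif b then σ (k, true) else σ (k, false)) = σ (k, b) := by cases b <;> rfl
  simp only [hJ, hε, prod_univ_sum, Fintype.piFinset_univ, mul_sum]
  rw [sum_comm (s := (univ : Finset (Equiv.Perm (κ × Bool))))]
  refine sum_congr rfl fun j _ => ?_
  rw [sum_comm]
  have h (ε : κ → Equiv.Perm Bool) : ∑ σ : Equiv.Perm (κ × Bool),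
      ((Equiv.Perm.sign σ : ℤ) : R) * ∏ k, (((Equiv.Perm.sign (ε k) : ℤ) : R) *
        (A (σ (k, ε k true)) (.inr (j k)) * A (σ (k, ε k false)) (.inl (j k)))) =
      (A.submatrix id (Sum.doubling j)).det := by
    rw [det_apply']
    refine Fintype.sum_equiv (Equiv.mulRight (Equiv.prodCongrRight ε)) _ _ fun σ => ?_
    rw [Fintype.prod_prod_type, prod_mul_distrib, ← mul_assoc]
    congr 1
    · rw [Equiv.coe_mulRight, Equiv.Perm.sign_mul, Equiv.Perm.sign_prodCongrRight]
      push_cast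
      rfl
    · refine prod_congr rfl fun k _ => ?_
      simp [Sum.doubling]
  simp only [h]
  simp [Fintype.card_perm]

theorem Matrix.sum_det_submatrix_of_mem_symplecticGroup {M : Matrix (l ⊕ l) (l ⊕ l) ℂ}
    (hM : M ∈ symplecticGroup l ℂ) (t : κ → l) :
    ∑ j : κ → l, (M.submatrix (Sum.doubling t) (Sum.doubling j)).det =
      ∑ j : κ → l,
        ((1 : Matrix (l ⊕ l) (l ⊕ l) ℂ).submatrix (Sum.doubling t) (Sum.doubling j)).det := by
  have h (M : Matrix (l ⊕ l) (l ⊕ l) ℂ) (hM : M ∈ symplecticGroup l ℂ) :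
      M.submatrix (Sum.doubling t) id * J l ℂ * (M.submatrix (Sum.doubling t) id)ᵀ =
        (J l ℂ).submatrix (Sum.doubling t) (Sum.doubling t) := by
    conv_rhs => rw [← SymplecticGroup.mem_iff.1 hM]
    rfl
  have h1 := sum_det_submatrix_doubling (M.submatrix (Sum.doubling t) id)
  have h2 := sum_det_submatrix_doubling
    ((1 : Matrix (l ⊕ l) (l ⊕ l) ℂ).submatrix (Sum.doubling t) id)
  rw [h M hM] at h1
  rw [h 1 (one_mem _), ← h1] at h2
  exact (mul_left_cancel₀ (pow_ne_zero _ two_ne_zero) h2).symm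

open Finset in
theorem Matrix.sum_det_one_submatrix_doubling {t : κ → l} (ht : Function.Injective t) :
    ∑ j : κ → l, ((1 : Matrix (l ⊕ l) (l ⊕ l) R).submatrix (Sum.doubling t)
      (Sum.doubling j)).det = (Fintype.card κ).factorial := by
  have hk (j : κ → l) : (1 : Matrix (l ⊕ l) (l ⊕ l) R).submatrix (Sum.doubling t)
      (Sum.doubling j) = kroneckerMap (· * ·) ((1 : Matrix l l R).submatrix t j)
        (1 : Matrix Bool Bool R) := by
    ext ⟨k, b⟩ ⟨k', b'⟩
    cases b <;> cases b' <;> simp [Sum.doubling, one_apply]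
  have hd (j : κ → l) : ((1 : Matrix (l ⊕ l) (l ⊕ l) R).submatrix (Sum.doubling t)
      (Sum.doubling j)).det = ∑ σ : Equiv.Perm κ, if j = t ∘ σ then
        ((Equiv.Perm.sign σ : ℤ) : R) * ((1 : Matrix l l R).submatrix t j).det else 0 := by
    rw [hk, det_kronecker, det_one, one_pow, mul_one, Fintype.card_bool, sq]
    nth_rewrite 1 [det_apply']
    rw [sum_mul]
    refine sum_congr rfl fun σ _ => ?_
    split_ifs with h
    · subst h
      have h1 (i : κ) : (1 : Matrix l l R) (t (σ i)) ((t ∘ σ) i) = 1 := one_apply_eq _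
      simp only [submatrix_apply, h1, prod_const_one, mul_one]
    · obtain ⟨k, hk⟩ := Function.ne_iff.1 h
      rw [prod_eq_zero (mem_univ k), mul_zero, zero_mul]
      exact one_apply_ne (Ne.symm hk)
  simp only [hd]
  rw [sum_comm, ← Fintype.card_perm, ← Finset.card_univ, card_eq_sum_ones, Nat.cast_sum]
  refine sum_congr rfl fun σ _ => ?_
  rw [sum_ite_eq' , if_pos (mem_univ _)]
  have : (1 : Matrix l l R).submatrix t (t ∘ σ) = (1 : Matrix κ κ R).submatrix id σ := by
    ext k k'
    simp [one_apply, ht.eq_iff]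
  rw [this, det_permute', det_one, mul_one]
  norm_cast
  simp

omit [Fintype l] in
theorem Matrix.det_submatrix_eq_minor (M : Matrix l l R) {a : κ → l} (ha : Function.Injective a)
    {s : Finset l} (hs : Finset.univ.image a = s) : (M.submatrix a a).det =
      (M.submatrix (Subtype.val : s → l) (Subtype.val : s → l)).det := by
  subst hs
  let e : κ ≃ (Finset.univ.image a : Finset l) :=
    Equiv.ofBijective (fun k => ⟨a k, Finset.mem_image_of_mem a (Finset.mem_univ k)⟩)
      ⟨fun _ _ h => ha (Subtype.ext_iff.1 h), fun ⟨x, hx⟩ => by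
        obtain ⟨k, _, rfl⟩ := Finset.mem_image.1 hx
        exact ⟨k, rfl⟩⟩
  rw [← det_submatrix_equiv_self e]
  rfl

open Finset in
theorem Finset.sum_injective_image {M : Type*} [CommRing M] (f : Finset l → M) :
    ∑ j : κ → l with Function.Injective j, f (univ.image j) =
      (Fintype.card κ).factorial * ∑ T ∈ powersetCard (Fintype.card κ) univ, f T := by
  have hmap : ∀ j ∈ univ.filter (fun j : κ → l => Function.Injective j),
      univ.image j ∈ powersetCard (Fintype.card κ) (univ : Finset l) := fun j hj => by
    rw [mem_powersetCard, card_image_of_injective _ (mem_filter.1 hj).2]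
    exact ⟨subset_univ _, card_univ⟩
  rw [← sum_fiberwise_of_maps_to hmap, mul_sum]
  refine sum_congr rfl fun T hT => ?_
  rw [sum_congr rfl fun j hj => by rw [(mem_filter.1 hj).2], sum_const, nsmul_eq_mul]
  congr 2
  have hcard : Fintype.card κ = Fintype.card T := by
    rw [Fintype.card_coe, (mem_powersetCard.1 hT).2]
  rw [← Fintype.card_equiv (Fintype.equivOfCardEq hcard), ← card_univ]
  refine (card_bij (fun (e : κ ≃ T) _ => Subtype.val ∘ e) (fun e _ => ?_) (fun e _ e' _ h => ?_)
    fun j hj => ?_).symm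
  · simp only [mem_filter, mem_univ, true_and]
    refine ⟨Subtype.val_injective.comp e.injective, ?_⟩
    rw [← image_image, image_univ_equiv]
    simp
  · exact Equiv.coe_fn_injective (Subtype.val_injective.comp_left h)
  · obtain ⟨hj1, rfl⟩ := mem_filter.1 hj
    refine ⟨Equiv.ofBijective (fun k => ⟨j k, mem_image_of_mem j (mem_univ k)⟩)
      ⟨fun _ _ h => (mem_filter.1 hj1).2 (Subtype.ext_iff.1 h), fun ⟨x, hx⟩ => ?_⟩, mem_univ _, rfl⟩
    obtain ⟨k, _, rfl⟩ := mem_image.1 hx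
    exact ⟨k, rfl⟩

omit [DecidableEq l] in
open Finset in
theorem Finset.sum_powersetCard_disjSum {M : Type*} [AddCommMonoid M] (m : ℕ)
    {F : Finset (l ⊕ l) → M} (hF : ∀ s, (∀ T : Finset l, s ≠ T.disjSum T) → F s = 0) :
    ∑ s ∈ powersetCard (2 * m) univ, F s = ∑ T ∈ powersetCard m univ, F (T.disjSum T) := by
  refine (sum_of_injOn (fun T : Finset l => T.disjSum T) (fun T _ T' _ h => ?_) (fun T hT => ?_)
    (fun s hs hs' => hF s ?_) fun _ _ => rfl).symm
  · ext x
    simpa using congrArg (Sum.inl x ∈ ·) h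
  · simp only [mem_coe, mem_powersetCard, card_disjSum] at hT ⊢
    exact ⟨subset_univ _, by omega⟩
  · rintro T rfl
    refine hs' ⟨T, ?_, rfl⟩
    simp only [mem_coe, mem_powersetCard, card_disjSum] at hs ⊢
    exact ⟨subset_univ _, by omega⟩

end SymplecticMinors

namespace USp

theorem continuous_minor {g : ℕ} (s : Finset (Fin g ⊕ Fin g)) :
    Continuous fun M : Matrix (Fin g ⊕ Fin g) (Fin g ⊕ Fin g) ℂ =>
      (M.submatrix (Subtype.val : s → _) (Subtype.val : s → _)).det :=
  continuous_det_submatrix _ _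

variable {g : ℕ} [MeasurableSpace (USp g)] [BorelSpace (USp g)] {μ : Measure (USp g)}
  [IsProbabilityMeasure μ]

open Finset in
theorem expect_minor_eq_zero (hinv : ∀ A : USp g, Measure.map (fun U => A * U) μ = μ)
    {s : Finset (Fin g ⊕ Fin g)} (hs : ∀ T : Finset (Fin g), s ≠ T.disjSum T) :
    expect μ (fun M => (M.submatrix (Subtype.val : s → _) (Subtype.val : s → _)).det) = 0 := by
  obtain ⟨k, hk⟩ : ∃ k, ¬ (Sum.inl k ∈ s ↔ Sum.inr k ∈ s) := by
    by_contra! h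
    refine hs (univ.filter fun k => Sum.inl k ∈ s) ?_
    ext (x | x) <;> simp [h]
  let u : Fin g → ℂ := Function.update 1 k (-1)
  have hu (i) : u i * star (u i) = 1 := by
    by_cases hi : i = k
    · subst hi; simp [u]
    · simp [u, hi]
  have hu' : (diagonal u).map star = diagonal u := by
    rw [diagonal_map (star_zero _)]
    congr 1
    ext i
    by_cases hi : i = k
    · subst hi; simp [u]
    · simp [u, hi]
  have hd := diagonal_mem_unitaryGroup hu
  refine expect_eq_zero_of_mul_left hinv (continuous_minor s)
    (fromBlocks_mem_unitaryGroup hd) (fromBlocks_mem_symplecticGroup hd) fun M => ?_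
  rw [hu', fromBlocks_diagonal, det_submatrix_diagonal_mul]
  congr 1
  have h (x : Fin g ⊕ Fin g) : Sum.elim u u x =
      (if x = .inl k then -1 else 1) * (if x = .inr k then -1 else 1) := by
    rcases x with x | x <;> simp [u, Function.update_apply]
  rw [prod_coe_sort s (Sum.elim u u)]
  simp only [h, prod_mul_distrib, prod_ite_eq']
  by_cases h1 : Sum.inl k ∈ s <;> by_cases h2 : Sum.inr k ∈ s <;> simp_all

theorem expect_esymmCoeff_odd (hinv : ∀ A : USp g, Measure.map (fun U => A * U) μ = μ)
    {n : ℕ} (hn : Odd n) : expect μ (esymmCoeff n) = 0 := by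
  rw [funext (esymmCoeff_eq_sum_minors (ι := Fin g ⊕ Fin g) (R := ℂ) n),
    expect_sum fun s _ => continuous_minor s]
  refine Finset.sum_eq_zero fun s hs => expect_minor_eq_zero hinv ?_
  rintro T rfl
  rw [Finset.mem_powersetCard, Finset.card_disjSum] at hs
  exact (Nat.not_even_iff_odd.2 hn) ⟨_, hs.2.symm⟩

omit [BorelSpace (USp g)] in
theorem expect_esymmCoeff_of_lt {n : ℕ} (hn : 2 * g < n) : expect μ (esymmCoeff n) = 0 := by
  have h (M : Matrix (Fin g ⊕ Fin g) (Fin g ⊕ Fin g) ℂ) : esymmCoeff n M = 0 := by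
    rw [esymmCoeff_eq_sum_minors, Finset.powersetCard_eq_empty.2, Finset.sum_empty]
    simp
    omega
  rw [funext h, expect_const]

theorem expect_det_submatrix_doubling (hinv : ∀ A : USp g, Measure.map (fun U => A * U) μ = μ)
    {κ : Type*} [Fintype κ] [DecidableEq κ] {t j : κ → Fin g} (ht : Function.Injective t)
    (hj : Function.Injective j) :
    expect μ (fun M => (M.submatrix (Sum.doubling t) (Sum.doubling j)).det) =
      expect μ (fun M => (M.submatrix (Sum.doubling j) (Sum.doubling j)).det) := by
  let e : {x // x ∈ Set.range t} ≃ {x // x ∈ Set.range j} :=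
    (Equiv.ofInjective t ht).symm.trans (Equiv.ofInjective j hj)
  let π : Equiv.Perm (Fin g) := e.extendSubtype
  have hπ (k : κ) : π (t k) = j k := by
    rw [Equiv.extendSubtype_apply_of_mem e _ ⟨k, rfl⟩]
    simp [e, Equiv.ofInjective_symm_apply]
  have hP := submatrix_one_mem_unitaryGroup π
  rw [← expect_mul_left hinv (continuous_det_submatrix _ _) (fromBlocks_mem_unitaryGroup hP)
    (fromBlocks_mem_symplecticGroup hP), fromBlocks_submatrix_one]
  refine congrArg (expect μ) (funext fun M => congrArg det ?_)
  ext ⟨k, b⟩ y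
  cases b <;> simp [Sum.doubling, mul_apply, one_apply, hπ]

open Finset in
theorem expect_esymmCoeff_even (hinv : ∀ A : USp g, Measure.map (fun U => A * U) μ = μ)
    {m : ℕ} (hm : m ≤ g) : expect μ (esymmCoeff (2 * m)) = 1 := by
  let f (T : Finset (Fin g)) : ℂ := expect μ fun M => (M.submatrix
    (Subtype.val : T.disjSum T → _) (Subtype.val : T.disjSum T → _)).det
  have h1 : expect μ (esymmCoeff (2 * m)) = ∑ T ∈ powersetCard m univ, f T := by
    rw [funext (esymmCoeff_eq_sum_minors (ι := Fin g ⊕ Fin g) (R := ℂ) (2 * m)),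
      expect_sum fun s _ => continuous_minor s]
    exact sum_powersetCard_disjSum m fun s hs => expect_minor_eq_zero hinv hs
  let t : Fin m → Fin g := Fin.castLE hm
  have ht : Function.Injective t := Fin.castLE_injective hm
  have h2 : ∑ j : Fin m → Fin g, expect μ (fun M => (M.submatrix (Sum.doubling t)
      (Sum.doubling j)).det) = m.factorial := by
    rw [← expect_sum fun j _ => continuous_det_submatrix _ _, expect_congr
      (G := fun _ => ((Fintype.card (Fin m)).factorial : ℂ)) μ fun U =>
      (sum_det_submatrix_of_mem_symplecticGroup U.2 t).trans (sum_det_one_submatrix_doubling ht),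
      expect_const, Fintype.card_fin]
  have h3 (j : Fin m → Fin g) : expect μ (fun M => (M.submatrix (Sum.doubling t)
      (Sum.doubling j)).det) = if Function.Injective j then f (univ.image j) else 0 := by
    split_ifs with hj
    · rw [expect_det_submatrix_doubling hinv ht hj]
      refine congrArg (expect μ) (funext fun M => ?_)
      refine det_submatrix_eq_minor M (Sum.doubling_injective hj) ?_
      ext (x | x) <;> simp [Sum.doubling]
    · obtain ⟨k, k', hkk, hne⟩ := Function.not_injective_iff.1 hj
      have h (M : Matrix (Fin g ⊕ Fin g) (Fin g ⊕ Fin g) ℂ) :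
          (M.submatrix (Sum.doubling t) (Sum.doubling j)).det = 0 :=
        det_zero_of_column_eq (i := (k, true)) (j := (k', true)) (by simpa using hne)
          (by simp [Sum.doubling, hkk])
      simp only [h, expect_const]
  simp only [h3] at h2
  rw [← sum_filter, sum_injective_image f, Fintype.card_fin, ← h1] at h2
  exact mul_left_cancel₀ (Nat.cast_ne_zero.2 m.factorial_ne_zero) (h2.trans (mul_one _).symm)

end USp

theorem Finset.Nat.sum_antidiagonal_succ_eq_add {M : Type*} [AddCommMonoid M] {f : ℕ × ℕ → M}
    (hf : ∀ i j, 2 ≤ j → f (i, j) = 0) (m : ℕ) :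
    ∑ x ∈ antidiagonal (m + 1), f x = f (m + 1, 0) + f (m, 1) := by
  rw [sum_antidiagonal_succ']
  cases m with
  | zero => simp
  | succ k =>
    rw [sum_antidiagonal_succ', sum_eq_zero fun x _ => hf x.1 (x.2 + 1 + 1) (by omega), add_zero]

theorem Matrix.hsymmCoeff_zero {ι : Type*} [Fintype ι] (A : Matrix ι ι ℂ) :
    hsymmCoeff 0 A = 1 := by
  simp [hsymmCoeff, permanentSum, permanent]

namespace USp

variable {g : ℕ} [MeasurableSpace (USp g)] [BorelSpace (USp g)] {μ : Measure (USp g)}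
  [IsProbabilityMeasure μ]

theorem expect_sum_esymmCoeff_mul_hsymmCoeff {κ : Type*} (s : Finset κ) (c : κ → ℂ)
    (p q : κ → ℕ) :
    expect μ (fun M => ∑ x ∈ s, c x * (esymmCoeff (p x) M * hsymmCoeff (q x) M)) =
      ∑ x ∈ s, c x * expect μ (fun M => esymmCoeff (p x) M * hsymmCoeff (q x) M) :=
  (expect_sum fun x _ => continuous_const.mul
    ((continuous_esymmCoeff (p x)).mul (continuous_hsymmCoeff (q x)))).trans
      (Finset.sum_congr rfl fun x _ => expect_const_mul (c x))

theorem expect_esymmCoeff_mul_hsymmCoeff_one (hg : 1 ≤ g)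
    (hinv : ∀ A : USp g, Measure.map (fun U => A * U) μ = μ) (m : ℕ) :
    expect μ (fun M => esymmCoeff m M * hsymmCoeff 1 M) = expect μ (esymmCoeff (m + 1)) := by
  have h : expect μ (fun M => ∑ x ∈ Finset.HasAntidiagonal.antidiagonal (m + 1),
      (-1) ^ x.1 * (esymmCoeff x.1 M * hsymmCoeff x.2 M)) = 0 := by
    rw [expect_congr (G := fun _ => 0) μ fun U => ?_, expect_const]
    obtain ⟨P, Q, l, hPQ, hA⟩ := exists_diagonalization_of_mem_unitaryGroup U.1.2
    exact sum_esymmCoeff_mul_hsymmCoeff hPQ hA m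
  rw [expect_sum_esymmCoeff_mul_hsymmCoeff, Finset.Nat.sum_antidiagonal_succ_eq_add fun i j hj => by
    simp [expect_esymmCoeff_mul_hsymmCoeff hg hinv i hj]] at h
  simp only [hsymmCoeff_zero, mul_one, pow_succ] at h
  have h1 : ((-1 : ℂ) ^ m) ≠ 0 := by simp
  refine mul_left_cancel₀ h1 ?_
  linear_combination h

theorem expect_trace_pow_succ (hg : 1 ≤ g)
    (hinv : ∀ A : USp g, Measure.map (fun U => A * U) μ = μ) (m : ℕ) :
    expect μ (fun M => trace (M ^ (m + 1))) = (-1) ^ m * expect μ (esymmCoeff (m + 1)) := by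
  rw [expect_congr (G := fun M => ∑ x ∈ Finset.HasAntidiagonal.antidiagonal m,
    ((-1) ^ x.1 * ((x.1 : ℂ) + 1)) * (esymmCoeff (x.1 + 1) M * hsymmCoeff x.2 M)) μ fun U => ?_]
  · rw [expect_sum_esymmCoeff_mul_hsymmCoeff]
    cases m with
    | zero => simp [hsymmCoeff_zero]
    | succ k =>
      rw [Finset.Nat.sum_antidiagonal_succ_eq_add fun i j hj => by
        simp [expect_esymmCoeff_mul_hsymmCoeff hg hinv (i + 1) hj]]
      simp only [hsymmCoeff_zero, mul_one, pow_succ, Nat.cast_add, Nat.cast_one,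
        expect_esymmCoeff_mul_hsymmCoeff_one hg hinv]
      ring
  · obtain ⟨P, Q, l, hPQ, hA⟩ := exists_diagonalization_of_mem_unitaryGroup U.1.2
    exact trace_pow_succ_eq_sum hPQ hA m

theorem expect_trace_pow (hg : 1 ≤ g)
    (hinv : ∀ A : USp g, Measure.map (fun U => A * U) μ = μ) {n : ℕ} (hn : n ≠ 0) :
    expect μ (fun M => trace (M ^ n)) = if n ≤ 2 * g then (if Even n then -1 else 0) else 0 := by
  obtain ⟨m, rfl⟩ := Nat.exists_eq_succ_of_ne_zero hn
  rw [Nat.succ_eq_add_one, expect_trace_pow_succ hg hinv]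
  split_ifs with h h2
  · obtain ⟨k, hk⟩ := h2
    have hm : Odd m := by
      refine Nat.not_even_iff_odd.1 fun h' => ?_
      exact absurd (Nat.even_add_one.1 ⟨k, hk⟩) (not_not.2 h')
    rw [hk, ← two_mul, expect_esymmCoeff_even hinv (by omega), hm.neg_one_pow, mul_one]
  · rw [expect_esymmCoeff_odd hinv (Nat.not_even_iff_odd.1 h2), mul_zero]
  · rw [expect_esymmCoeff_of_lt (by omega), mul_zero]

end USp

/-- The expected value of `tr(U^n)` over `USp(2g)` with respect to the Haar
probability measure (i.e., a left-invariant Borel probability measure) equals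
`2g` for `n = 0`, `-1` for even `n` with `1 ≤ |n| ≤ 2g`, `0` for odd `n` with
`1 ≤ |n| ≤ 2g`, and `0` for `|n| > 2g`. -/
theorem USp_expected_trace_pow (g : ℕ) (hg : 1 ≤ g)
    [MeasurableSpace (USp g)] [BorelSpace (USp g)]
    (μ : Measure (USp g)) [IsProbabilityMeasure μ]
    (hinv : ∀ A : USp g, Measure.map (fun U => A * U) μ = μ) (n : ℤ) :
    (∫ U : USp g,
        Matrix.trace (((U ^ n : USp g) : Matrix.unitaryGroup (Fin g ⊕ Fin g) ℂ) :
          Matrix (Fin g ⊕ Fin g) (Fin g ⊕ Fin g) ℂ) ∂μ) =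
      if n = 0 then (2 * g : ℂ)
      else if n.natAbs ≤ 2 * g then (if Even n then -1 else 0)
      else 0 := by
  obtain rfl | hn := eq_or_ne n 0
  · simp [two_mul]
  rw [if_neg hn]
  have h := USp.expect_trace_pow hg hinv (Int.natAbs_ne_zero.2 hn)
  simp only [Int.natAbs_even] at h
  rw [USp.expect] at h
  obtain hk | hk := Int.natAbs_eq n
  · rw [← h]
    refine integral_congr_ae (ae_of_all _ fun U => ?_)
    dsimp only
    conv_lhs => rw [hk]
    rw [zpow_natCast, SubmonoidClass.coe_pow, SubmonoidClass.coe_pow]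
  · have h' := congrArg (starRingEnd ℂ) h
    rw [← integral_conj] at h'
    refine Eq.trans (integral_congr_ae (ae_of_all _ fun U => ?_)) (h'.trans ?_)
    · dsimp only
      conv_lhs => rw [hk]
      rw [_root_.zpow_neg, zpow_natCast, InvMemClass.coe_inv, UnitaryGroup.inv_val,
        star_eq_conjTranspose, trace_conjTranspose, SubmonoidClass.coe_pow,
        SubmonoidClass.coe_pow]
      rfl
    · split_ifs <;> simp
end
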